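/- Rearrangement inequality for random walks with domain constraints: Let φ : ℝ^d → [0,∞) be a probability density (measurable with ∫_{ℝ^d} φ = 1) vanishing at infinity, let f₁,…,f_m : ℝ^d → [0,∞) be continuous functions vanishing at infinity, let D₁,…,D_m ⊆ ℝ^d be nonempty open sets of finite Lebesgue measure, and let 0 ≤ k₁ ≤ ⋯ ≤ k_m be integers with k_m ≥ 1. Then for every x₀ ∈ ℝ^d, ∫_{(ℝ^d)^{k_m}} ∏_{i=1}^m [f_i(x₀ + x₁ + ⋯ + x_{k_i}) · 1_{D_i}(x₀ + x₁ + ⋯ + x_{k_i})] ∏_{j=1}^{k_m} φ(x_j) dx₁⋯dx_{k_m} ≤ ∫_{(ℝ^d)^{k_m}} ∏_{i=1}^m [f_i*(x₁ + ⋯ + x_{k_i}) · 1_{D_i*}(x₁ + ⋯ + x_{k_i})] ∏_{j=1}^{k_m} φ*(x_j) dx₁⋯dx_{k_m}, where an empty sum of the x_j's is understood to be 0 and both integrals are taken in [0,∞]. -/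

import Mathlib

open MeasureTheory ENNReal Filter Topology
open scoped RealInnerProductSpace

/-- A nonnegative function on `ℝ^d` vanishes at infinity if all its positive
super-level sets have finite Lebesgue measure. -/
def VanishesAtInfinity {d : ℕ} (f : EuclideanSpace ℝ (Fin d) → ℝ) : Prop :=
  ∀ t : ℝ, 0 < t → volume {x : EuclideanSpace ℝ (Fin d) | t < f x} < ⊤

/-- Radius of the ball centered at the origin having the same volume as `A`. -/
noncomputable def symmRadius {d : ℕ} (A : Set (EuclideanSpace ℝ (Fin d))) : ℝ :=
  ((volume A / volume (Metric.ball (0 : EuclideanSpace ℝ (Fin d)) 1)).toReal) ^ ((1 : ℝ) / d)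

/-- `A*`: the open ball centered at the origin with the same Lebesgue measure as `A`. -/
noncomputable def ballStar {d : ℕ} (A : Set (EuclideanSpace ℝ (Fin d))) :
    Set (EuclideanSpace ℝ (Fin d)) :=
  Metric.ball 0 (symmRadius A)

/-- Symmetric decreasing rearrangement `f*` (with values in `[0,∞]`):
`f*(x) = ∫₀^∞ 1_{{f>t}*}(x) dt`. -/
noncomputable def symmRearrange {d : ℕ} (f : EuclideanSpace ℝ (Fin d) → ℝ)
    (x : EuclideanSpace ℝ (Fin d)) : ℝ≥0∞ :=
  ∫⁻ t in Set.Ioi (0 : ℝ), (ballStar {y | t < f y}).indicator (fun _ => (1 : ℝ≥0∞)) x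

/-- `x₁ + ⋯ + x_n` for a configuration `x` (indices shifted by one: `x j` is `x_{j+1}`);
an empty sum is `0`. -/
noncomputable def partialSum {d K : ℕ} (x : Fin K → EuclideanSpace ℝ (Fin d)) (n : ℕ) :
    EuclideanSpace ℝ (Fin d) :=
  ∑ j : Fin K, if (j : ℕ) < n then x j else 0

/-- A finite atomless measure on the line takes every intermediate value on closed left rays. -/
lemma exists_measure_Iic_eq (ν : Measure ℝ) [IsFiniteMeasure ν] [NullSingletonClass ν] {t : ℝ≥0∞}
    (h0 : 0 < t) (ht : t < ν Set.univ) : ∃ β, ν (Set.Iic β) = t := by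
  have hcont : Continuous fun β : ℝ => ν (Set.Iic β) := by
    rw [continuous_iff_continuousAt]
    intro β
    refine tendsto_measure_of_ae_tendsto_indicator_of_isFiniteMeasure (𝓝 β) measurableSet_Iic
      (fun _ => measurableSet_Iic) ?_
    have : ∀ᵐ x ∂ν, x ≠ β := by
      rw [ae_iff]; simp
    filter_upwards [this] with x hx
    rcases lt_or_gt_of_ne hx with h | h
    · filter_upwards [lt_mem_nhds h] with γ hγ
      simp [hγ.le, h.le]
    · filter_upwards [gt_mem_nhds h] with γ hγ
      simp [hγ.not_ge, h.not_ge]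
  have hbot : Tendsto (fun β : ℝ => ν (Set.Iic β)) atBot (𝓝 (ν ∅)) := by
    refine tendsto_measure_of_ae_tendsto_indicator_of_isFiniteMeasure _ MeasurableSet.empty
      (fun _ => measurableSet_Iic) (ae_of_all _ fun x => ?_)
    filter_upwards [eventually_lt_atBot x] with γ hγ
    simp [hγ]
  rw [measure_empty] at hbot
  have htop := tendsto_measure_Iic_atTop ν
  exact mem_range_of_exists_le_of_exists_ge hcont
    ((hbot.eventually (gt_mem_nhds h0)).exists.imp fun _ h => h.le)
    ((htop.eventually (lt_mem_nhds ht)).exists.imp fun _ h => h.le)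

/-- The measure of the pairs in `A × B` whose sum lies in `C`. -/
noncomputable def sumTriple {G : Type*} [MeasureSpace G] [Add G] (A B C : Set G) : ℝ≥0∞ :=
  volume {p : G × G | p.1 ∈ A ∧ p.2 ∈ B ∧ p.1 + p.2 ∈ C}

lemma sumTriple_mono {G : Type*} [MeasureSpace G] [Add G] {A B C A' B' C' : Set G}
    (hA : A ⊆ A') (hB : B ⊆ B') (hC : C ⊆ C') :
    sumTriple A B C ≤ sumTriple A' B' C' :=
  measure_mono fun _ h => ⟨hA h.1, hB h.2.1, hC h.2.2⟩

lemma measurableSet_sumTriple {G : Type*} [MeasureSpace G] [Add G] [MeasurableAdd₂ G]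
    {A B C : Set G} (hA : MeasurableSet A) (hB : MeasurableSet B)
    (hC : MeasurableSet C) :
    MeasurableSet {p : G × G | p.1 ∈ A ∧ p.2 ∈ B ∧ p.1 + p.2 ∈ C} :=
  (measurable_fst hA).inter ((measurable_snd hB).inter ((measurable_fst.add measurable_snd) hC))

lemma sumTriple_comm {G : Type*} [MeasureSpace G] [AddCommGroup G] [MeasurableAdd₂ G]
    [SFinite (volume : Measure G)] {A B C : Set G} (hA : MeasurableSet A) (hB : MeasurableSet B)
    (hC : MeasurableSet C) : sumTriple A B C = sumTriple B A C := by
  unfold sumTriple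
  rw [Measure.volume_eq_prod, ← (Measure.measurePreserving_swap (μ := (volume : Measure G))
    (ν := (volume : Measure G))).measure_preimage
    (measurableSet_sumTriple hA hB hC).nullMeasurableSet]
  congr 1
  ext p
  simp [add_comm, and_left_comm]

lemma sumTriple_le_left {G : Type*} [MeasureSpace G] [Add G] [SFinite (volume : Measure G)]
    (A B C : Set G) : sumTriple A B C ≤ volume A * volume B := by
  rw [← Measure.prod_prod]
  exact measure_mono fun p h => ⟨h.1, h.2.1⟩

lemma sumTriple_le_mid {G : Type*} [MeasureSpace G] [AddCommGroup G] [MeasurableAdd₂ G]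
    [SFinite (volume : Measure G)] [(volume : Measure G).IsAddLeftInvariant]
    {A B C : Set G} (hA : MeasurableSet A) (hC : MeasurableSet C) :
    sumTriple A B C ≤ volume A * volume C := by
  rw [← Measure.prod_prod, ← (measurePreserving_prod_add (volume : Measure G)
    (volume : Measure G)).measure_preimage (hA.prod hC).nullMeasurableSet]
  exact measure_mono fun p h => ⟨h.1, h.2.2⟩

lemma sumTriple_le_right {G : Type*} [MeasureSpace G] [AddCommGroup G] [MeasurableAdd₂ G]
    [SFinite (volume : Measure G)] [(volume : Measure G).IsAddLeftInvariant]
    {A B C : Set G} (hA : MeasurableSet A) (hB : MeasurableSet B)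
    (hC : MeasurableSet C) : sumTriple A B C ≤ volume B * volume C := by
  rw [sumTriple_comm hA hB hC]
  exact sumTriple_le_mid hB hC

/-- If `A × B` is split along level `t`, the pairs whose sum lies in `C` are controlled by
the two blocks. -/
lemma sumTriple_real_le {A B C : Set ℝ} (hA : MeasurableSet A) (hB : MeasurableSet B)
    (hC : MeasurableSet C) (hAf : volume A ≠ ⊤) (hBf : volume B ≠ ⊤) {t : ℝ≥0∞} (h0 : 0 < t)
    (hta : t < volume A) (htb : t < volume B) :
    sumTriple A B C ≤ t * volume C + (volume A - t) * (volume B - t) := by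
  have ht : t ≠ ⊤ := (hta.trans_le le_top).ne
  have : IsFiniteMeasure (volume.restrict A) := ⟨by simpa using hAf.lt_top⟩
  have : IsFiniteMeasure (volume.restrict B) := ⟨by simpa using hBf.lt_top⟩
  obtain ⟨β, hβ⟩ := exists_measure_Iic_eq (volume.restrict B) h0 (by simpa using htb)
  obtain ⟨α, hα⟩ := exists_measure_Iic_eq (volume.restrict A) (t := volume A - t)
    (tsub_pos_of_lt hta) (by
      simpa using ENNReal.sub_lt_self hAf (h0.trans hta).ne' h0.ne')
  rw [Measure.restrict_apply measurableSet_Iic, Set.inter_comm] at hβ hα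
  have hβ' : volume (B ∩ Set.Ioi β) = volume B - t := by
    have := measure_inter_add_sdiff (μ := volume) B (measurableSet_Iic (a := β))
    rw [Set.sdiff_eq, Set.compl_Iic, hβ] at this
    rw [← this, ENNReal.add_sub_cancel_left ht]
  have hα' : volume (A ∩ Set.Ici α) = t := by
    have := measure_inter_add_sdiff (μ := volume) A (measurableSet_Iic (a := α))
    rw [Set.sdiff_eq, Set.compl_Iic, hα] at this
    have h2 : volume A - t + t = volume A := tsub_add_cancel_of_le hta.le
    have h3 : volume (A ∩ Set.Ici α) = volume (A ∩ Set.Ioi α) :=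
      measure_congr ((Filter.EventuallyEq.refl _ A).inter Ioi_ae_eq_Ici.symm)
    rw [h3]
    exact (ENNReal.add_right_inj (ENNReal.sub_ne_top hAf)).1 (this.trans h2.symm)
  set P : Set (ℝ × ℝ) := {p | p.1 ∈ A ∧ p.2 - p.1 ∈ B ∧ p.2 ∈ C ∧ (α < p.1 ∨ p.2 - p.1 ≤ β)}
    with hP
  have hPm : MeasurableSet P := by
    have h1 : Measurable fun p : ℝ × ℝ => p.2 - p.1 := measurable_snd.sub measurable_fst
    exact (measurable_fst hA).inter ((h1 hB).inter ((measurable_snd hC).inter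
      ((measurable_fst measurableSet_Ioi).union (h1 measurableSet_Iic))))
  have hPle : volume P ≤ t * volume C := by
    rw [Measure.volume_eq_prod, Measure.prod_apply_symm hPm]
    calc ∫⁻ s, volume ((fun x => (x, s)) ⁻¹' P) ≤ ∫⁻ s, C.indicator (fun _ => t) s := by
          refine lintegral_mono fun s => ?_
          by_cases hs : s ∈ C
          · rw [Set.indicator_of_mem hs]
            rcases le_total (s - β) α with h | h
            · have : (fun x => (x, s)) ⁻¹' P ⊆ (fun x => s - x) ⁻¹' (B ∩ Set.Iic β) := by
                rintro x ⟨_, h2, _, h4⟩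
                refine ⟨h2, ?_⟩
                simp only [Set.mem_Iic] at *
                rcases h4 with h4 | h4 <;> linarith
              refine (measure_mono this).trans ?_
              rw [(Measure.measurePreserving_sub_left volume s).measure_preimage
                (hB.inter measurableSet_Iic).nullMeasurableSet, hβ]
            · rw [← hα']
              refine measure_mono ?_
              rintro x ⟨h1, h2, _, h4⟩
              refine ⟨h1, ?_⟩
              simp only [Set.mem_Ici] at *
              rcases h4 with h4 | h4 <;> linarith
          · rw [Set.indicator_of_notMem hs]
            have : (fun x => (x, s)) ⁻¹' P = ∅ := by
              ext x; simp [hP, hs]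
            simp [this]
      _ = t * volume C := by rw [lintegral_indicator hC, setLIntegral_const]
  have hsub : {p : ℝ × ℝ | p.1 ∈ A ∧ p.2 ∈ B ∧ p.1 + p.2 ∈ C} ⊆
      (fun z : ℝ × ℝ => (z.1, z.1 + z.2)) ⁻¹' P ∪ (A ∩ Set.Iic α) ×ˢ (B ∩ Set.Ioi β) := by
    rintro ⟨x, y⟩ ⟨h1, h2, h3⟩
    simp only at h1 h2 h3
    by_cases h : α < x ∨ y ≤ β
    · left
      exact ⟨h1, by simpa using h2, h3, by simpa using h⟩
    · right
      push Not at h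
      exact ⟨⟨h1, h.1⟩, ⟨h2, h.2⟩⟩
  refine (measure_mono hsub).trans ((measure_union_le _ _).trans ?_)
  gcongr
  · rw [Measure.volume_eq_prod, (measurePreserving_prod_add (volume : Measure ℝ)
      (volume : Measure ℝ)).measure_preimage hPm.nullMeasurableSet, ← Measure.volume_eq_prod]
    exact hPle
  · rw [Measure.volume_eq_prod, Measure.prod_prod, hα, hβ']

/-- The open interval of length `a` centered at the origin. -/
def centeredInterval (a : ℝ) : Set ℝ := {x | 2 * |x| < a}

lemma mem_centeredInterval {a x : ℝ} : x ∈ centeredInterval a ↔ -a < 2 * x ∧ 2 * x < a := by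
  have : 2 * |x| = |2 * x| := by rw [abs_mul]; simp
  rw [centeredInterval, Set.mem_ofPred_eq, this, abs_lt]

lemma centeredInterval_eq_Ioo (a : ℝ) : centeredInterval a = Set.Ioo (-(a / 2)) (a / 2) := by
  ext x
  rw [mem_centeredInterval, Set.mem_Ioo]
  constructor <;> rintro ⟨h1, h2⟩ <;> constructor <;> linarith

lemma measurableSet_centeredInterval (a : ℝ) : MeasurableSet (centeredInterval a) := by
  rw [centeredInterval_eq_Ioo]; exact measurableSet_Ioo

lemma volume_centeredInterval (a : ℝ) : volume (centeredInterval a) = ENNReal.ofReal a := by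
  rw [centeredInterval_eq_Ioo, Real.volume_Ioo]; congr 1; ring

lemma volume_corner_le {a b c t : ℝ} (ht : 0 ≤ t) (habc : 2 * t = a + b - c) :
    volume {p : ℝ × ℝ | 2 * p.1 < a ∧ 2 * p.2 < b ∧ c ≤ 2 * (p.1 + p.2)} ≤
      ENNReal.ofReal (t ^ 2 / 2) := by
  have hm : MeasurableSet {p : ℝ × ℝ | 2 * p.1 < a ∧ 2 * p.2 < b ∧ c ≤ 2 * (p.1 + p.2)} := by
    exact (measurableSet_lt (f := fun p : ℝ × ℝ => 2 * p.1) (by fun_prop) measurable_const).inter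
      ((measurableSet_lt (f := fun p : ℝ × ℝ => 2 * p.2) (by fun_prop) measurable_const).inter
      (measurableSet_le (g := fun p : ℝ × ℝ => 2 * (p.1 + p.2)) measurable_const (by fun_prop)))
  rw [Measure.volume_eq_prod, Measure.prod_apply hm]
  have hint : ∫ x in (a / 2 - t)..(a / 2), (x - (a / 2 - t)) = t ^ 2 / 2 := by
    rw [intervalIntegral.integral_sub (by simp) (by simp)]
    simp [integral_id]
    ring
  calc _ ≤ ∫⁻ x, (Set.Ioc (a / 2 - t) (a / 2)).indicator
        (fun x => ENNReal.ofReal (x - (a / 2 - t))) x := by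
        refine lintegral_mono fun x => ?_
        by_cases hx : x ∈ Set.Ioc (a / 2 - t) (a / 2)
        · rw [Set.indicator_of_mem hx]
          have : ENNReal.ofReal (x - (a / 2 - t)) = volume (Set.Ico (c / 2 - x) (b / 2)) := by
            rw [Real.volume_Ico]; congr 1; linarith
          rw [this]
          refine measure_mono ?_
          rintro y ⟨_, h2, h3⟩
          simp only at h2 h3
          exact ⟨by linarith, by linarith⟩
        · have : Prod.mk x ⁻¹' {p : ℝ × ℝ | 2 * p.1 < a ∧ 2 * p.2 < b ∧ c ≤ 2 * (p.1 + p.2)}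
              = ∅ := by
            ext y
            simp only [Set.mem_preimage, Set.mem_ofPred_eq, Set.mem_empty_iff_false, iff_false]
            rintro ⟨h1, h2, h3⟩
            exact hx ⟨by linarith, by linarith⟩
          simp [this]
    _ = ENNReal.ofReal (t ^ 2 / 2) := by
        rw [lintegral_indicator measurableSet_Ioc, ← hint,
          intervalIntegral.integral_of_le (by linarith), ofReal_integral_eq_lintegral_ofReal]
        · exact (Continuous.integrableOn_Icc (by fun_prop)).mono_set Set.Ioc_subset_Icc_self
        · filter_upwards [ae_restrict_mem measurableSet_Ioc] with x hx
          exact sub_nonneg.2 hx.1.le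

lemma le_sumTriple_centeredInterval {a b c t : ℝ} (ha : 0 ≤ a) (ht : 0 ≤ t)
    (habc : 2 * t = a + b - c) :
    ENNReal.ofReal (a * b) ≤
      sumTriple (centeredInterval a) (centeredInterval b) (centeredInterval c) +
        ENNReal.ofReal (t ^ 2) := by
  set T : Set (ℝ × ℝ) := {p : ℝ × ℝ | 2 * p.1 < a ∧ 2 * p.2 < b ∧ c ≤ 2 * (p.1 + p.2)} with hT
  have hsub : centeredInterval a ×ˢ centeredInterval b ⊆
      {p : ℝ × ℝ | p.1 ∈ centeredInterval a ∧ p.2 ∈ centeredInterval b ∧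
        p.1 + p.2 ∈ centeredInterval c} ∪ (T ∪ -T) := by
    rintro ⟨x, y⟩ ⟨hx, hy⟩
    simp only at hx hy
    by_cases h : x + y ∈ centeredInterval c
    · exact Or.inl ⟨hx, hy, h⟩
    · right
      rw [mem_centeredInterval] at h hx hy
      by_cases h1 : c ≤ 2 * (x + y)
      · exact Or.inl ⟨hx.2, hy.2, h1⟩
      · refine Or.inr ⟨?_, ?_, ?_⟩
        · simp only [Prod.fst_neg]; linarith
        · simp only [Prod.snd_neg]; linarith
        · simp only [Prod.fst_neg, Prod.snd_neg]
          by_contra h2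
          exact h ⟨by linarith, by linarith⟩
  have hneg : volume (-T) = volume T := by
    rw [Measure.volume_eq_prod]
    exact Measure.measure_neg _ _
  have hTle := volume_corner_le ht habc
  calc ENNReal.ofReal (a * b) = volume (centeredInterval a ×ˢ centeredInterval b) := by
        rw [Measure.volume_eq_prod, Measure.prod_prod, volume_centeredInterval,
          volume_centeredInterval, ENNReal.ofReal_mul ha]
    _ ≤ _ := measure_mono hsub
    _ ≤ _ := measure_union_le _ _
    _ ≤ _ := by
        refine add_le_add le_rfl ((measure_union_le _ _).trans ?_)
        rw [hneg]
        refine (add_le_add hTle hTle).trans ?_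
        rw [← ENNReal.ofReal_add (by positivity) (by positivity)]
        exact ENNReal.ofReal_le_ofReal (by linarith)

/-- **Riesz–Sobolev inequality on the line**, for sets. -/
theorem sumTriple_real_le_centeredInterval {A B C : Set ℝ} (hA : MeasurableSet A)
    (hB : MeasurableSet B) (hC : MeasurableSet C) (hAf : volume A ≠ ⊤) (hBf : volume B ≠ ⊤)
    (hCf : volume C ≠ ⊤) :
    sumTriple A B C ≤ sumTriple (centeredInterval (volume A).toReal)
      (centeredInterval (volume B).toReal) (centeredInterval (volume C).toReal) := by
  obtain ⟨a, ha⟩ : ∃ a, a = (volume A).toReal := ⟨_, rfl⟩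
  obtain ⟨b, hb⟩ : ∃ b, b = (volume B).toReal := ⟨_, rfl⟩
  obtain ⟨c, hc⟩ : ∃ c, c = (volume C).toReal := ⟨_, rfl⟩
  have ha0 : 0 ≤ a := ha ▸ ENNReal.toReal_nonneg
  have hb0 : 0 ≤ b := hb ▸ ENNReal.toReal_nonneg
  have hc0 : 0 ≤ c := hc ▸ ENNReal.toReal_nonneg
  have hA' : volume A = ENNReal.ofReal a := by rw [ha, ENNReal.ofReal_toReal hAf]
  have hB' : volume B = ENNReal.ofReal b := by rw [hb, ENNReal.ofReal_toReal hBf]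
  have hC' : volume C = ENNReal.ofReal c := by rw [hc, ENNReal.ofReal_toReal hCf]
  rw [← ha, ← hb, ← hc]
  rcases le_or_gt (a + b) c with h1 | h1
  · refine (sumTriple_le_left A B C).trans ?_
    rw [hA', hB', ← volume_centeredInterval, ← volume_centeredInterval, ← Measure.prod_prod]
    refine measure_mono ?_
    rintro ⟨x, y⟩ ⟨hx, hy⟩
    simp only [mem_centeredInterval] at hx hy
    refine ⟨mem_centeredInterval.2 hx, mem_centeredInterval.2 hy, mem_centeredInterval.2 ?_⟩
    simp only
    constructor <;> linarith
  rcases le_or_gt (b + c) a with h2 | h2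
  · refine (sumTriple_le_right hA hB hC).trans ?_
    rw [sumTriple_comm (measurableSet_centeredInterval _) (measurableSet_centeredInterval _)
      (measurableSet_centeredInterval _), hB', hC', ← volume_centeredInterval,
      ← volume_centeredInterval, ← Measure.prod_prod, ← (measurePreserving_prod_add
      (volume : Measure ℝ) (volume : Measure ℝ)).measure_preimage
      ((measurableSet_centeredInterval _).prod
        (measurableSet_centeredInterval _)).nullMeasurableSet]
    refine measure_mono ?_
    rintro ⟨x, y⟩ ⟨hx, hy⟩
    simp only [mem_centeredInterval] at hx hy
    refine ⟨mem_centeredInterval.2 hx, mem_centeredInterval.2 ?_, mem_centeredInterval.2 hy⟩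
    simp only
    constructor <;> linarith
  rcases le_or_gt (a + c) b with h3 | h3
  · refine (sumTriple_le_mid hA hC).trans ?_
    rw [hA', hC', ← volume_centeredInterval,
      ← volume_centeredInterval, ← Measure.prod_prod, ← (measurePreserving_prod_add
      (volume : Measure ℝ) (volume : Measure ℝ)).measure_preimage
      ((measurableSet_centeredInterval _).prod
        (measurableSet_centeredInterval _)).nullMeasurableSet]
    refine measure_mono ?_
    rintro ⟨x, y⟩ ⟨hx, hy⟩
    simp only [mem_centeredInterval] at hx hy
    refine ⟨mem_centeredInterval.2 hx, mem_centeredInterval.2 ?_, mem_centeredInterval.2 hy⟩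
    simp only
    constructor <;> linarith
  obtain ⟨t, ht⟩ : ∃ t, 2 * t = a + b - c := ⟨(a + b - c) / 2, by ring⟩
  have ht0 : 0 < t := by linarith
  have hta : t < a := by linarith
  have htb : t < b := by linarith
  have hup := sumTriple_real_le hA hB hC hAf hBf (t := ENNReal.ofReal t)
    (ENNReal.ofReal_pos.2 ht0)
    (by rw [hA']; exact (ENNReal.ofReal_lt_ofReal_iff (by linarith)).2 hta)
    (by rw [hB']; exact (ENNReal.ofReal_lt_ofReal_iff (by linarith)).2 htb)
  rw [hA', hB', hC', ← ENNReal.ofReal_sub _ ht0.le, ← ENNReal.ofReal_sub _ ht0.le,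
    ← ENNReal.ofReal_mul ht0.le, ← ENNReal.ofReal_mul (by linarith),
    ← ENNReal.ofReal_add (by positivity) (mul_nonneg (by linarith) (by linarith))] at hup
  have hlow := le_sumTriple_centeredInterval ha0 ht0.le ht
  refine hup.trans ?_
  rw [← ENNReal.add_le_add_iff_right (ENNReal.ofReal_ne_top (r := t ^ 2)),
    ← ENNReal.ofReal_add (by
      have := mul_nonneg (sub_nonneg.2 hta.le) (sub_nonneg.2 htb.le)
      positivity) (by positivity)]
  refine le_trans (le_of_eq ?_) hlow
  congr 1
  have : c = a + b - 2 * t := by linarith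
  rw [this]; ring

/-- The horizontal slice of a set in a product with the line. -/
def slice {F : Type*} (A : Set (ℝ × F)) (y : F) : Set ℝ := (fun t => (t, y)) ⁻¹' A

/-- Steiner symmetrization along the first factor of `ℝ × F`. -/
def steiner {F : Type*} (A : Set (ℝ × F)) : Set (ℝ × F) :=
  {p | p.1 ∈ centeredInterval (volume (slice A p.2)).toReal}

lemma slice_steiner {F : Type*} (A : Set (ℝ × F)) (y : F) :
    slice (steiner A) y = centeredInterval (volume (slice A y)).toReal := rfl

lemma measurableSet_slice {F : Type*} [MeasurableSpace F] {A : Set (ℝ × F)}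
    (hA : MeasurableSet A) (y : F) : MeasurableSet (slice A y) :=
  (measurable_id.prodMk measurable_const) hA

lemma measurable_volume_slice {F : Type*} [MeasurableSpace F] {A : Set (ℝ × F)}
    (hA : MeasurableSet A) : Measurable fun y => volume (slice A y) :=
  measurable_measure_prodMk_right hA

lemma measurableSet_steiner {F : Type*} [MeasurableSpace F] {A : Set (ℝ × F)}
    (hA : MeasurableSet A) : MeasurableSet (steiner A) := by
  refine measurableSet_lt (f := fun p : ℝ × F => 2 * |p.1|)
    (g := fun p : ℝ × F => (volume (slice A p.2)).toReal) ?_ ?_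
  · exact (continuous_abs.measurable.comp measurable_fst).const_mul 2
  · exact ((measurable_volume_slice hA).comp measurable_snd).ennreal_toReal

lemma measurableAdd₂_prod {F : Type*} [MeasurableSpace F] [AddCommGroup F] [MeasurableAdd₂ F] :
    MeasurableAdd₂ (ℝ × F) :=
  ⟨Measurable.prodMk (by fun_prop) (by fun_prop)⟩

section

variable {F : Type*} [MeasureSpace F] [SFinite (volume : Measure F)]

lemma volume_eq_lintegral_slice {A : Set (ℝ × F)} (hA : MeasurableSet A) :
    volume A = ∫⁻ y, volume (slice A y) := by
  rw [Measure.volume_eq_prod, Measure.prod_apply_symm hA]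
  rfl

lemma volume_steiner {A : Set (ℝ × F)} (hA : MeasurableSet A)
    (hfin : ∀ y, volume (slice A y) ≠ ⊤) : volume (steiner A) = volume A := by
  rw [volume_eq_lintegral_slice hA, volume_eq_lintegral_slice (measurableSet_steiner hA)]
  refine lintegral_congr fun y => ?_
  rw [slice_steiner, volume_centeredInterval, ENNReal.ofReal_toReal (hfin y)]

lemma sumTriple_prod_eq [AddCommGroup F] [MeasurableAdd₂ F] {A B C : Set (ℝ × F)}
    (hA : MeasurableSet A) (hB : MeasurableSet B) (hC : MeasurableSet C) :
    sumTriple A B C =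
      ∫⁻ y, ∫⁻ y', sumTriple (slice A y) (slice B y') (slice C (y + y')) := by
  have := measurableAdd₂_prod (F := F)
  have hS := measurableSet_sumTriple hA hB hC
  set S := {p : (ℝ × F) × (ℝ × F) | p.1 ∈ A ∧ p.2 ∈ B ∧ p.1 + p.2 ∈ C} with hSdef
  have hg : Measurable (S.indicator (1 : (ℝ × F) × (ℝ × F) → ℝ≥0∞)) := measurable_one.indicator hS
  unfold sumTriple
  rw [← hSdef, ← lintegral_indicator_one hS, Measure.volume_eq_prod,
    lintegral_prod _ hg.aemeasurable,
    Measure.volume_eq_prod, lintegral_prod_symm _ (hg.lintegral_prod_right').aemeasurable]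
  refine lintegral_congr fun y => ?_
  have h1 : ∀ t : ℝ,
      ∫⁻ q, S.indicator 1 ((t, y), q) ∂((volume : Measure ℝ).prod (volume : Measure F))
      = ∫⁻ y', ∫⁻ t', S.indicator 1 ((t, y), (t', y')) := fun t =>
    lintegral_prod_symm _ (by fun_prop)
  simp_rw [h1]
  rw [lintegral_lintegral_swap]
  · refine lintegral_congr fun y' => ?_
    have hm := measurableSet_sumTriple (measurableSet_slice hA y) (measurableSet_slice hB y')
      (measurableSet_slice hC (y + y'))
    rw [← lintegral_indicator_one hm, Measure.volume_eq_prod, lintegral_prod]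
    · rfl
    · exact (measurable_one.indicator hm).aemeasurable
  · refine Measurable.aemeasurable ?_
    refine Measurable.lintegral_prod_right' (f := fun p : (ℝ × F) × ℝ => 
      S.indicator (1 : (ℝ × F) × (ℝ × F) → ℝ≥0∞) ((p.1.1, y), (p.2, p.1.2))) ?_
    fun_prop

lemma sumTriple_le_steiner [AddCommGroup F] [MeasurableAdd₂ F] {A B C : Set (ℝ × F)}
    (hA : MeasurableSet A) (hB : MeasurableSet B) (hC : MeasurableSet C)
    (hAf : ∀ y, volume (slice A y) ≠ ⊤) (hBf : ∀ y, volume (slice B y) ≠ ⊤)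
    (hCf : ∀ y, volume (slice C y) ≠ ⊤) :
    sumTriple A B C ≤ sumTriple (steiner A) (steiner B) (steiner C) := by
  rw [sumTriple_prod_eq hA hB hC, sumTriple_prod_eq (measurableSet_steiner hA)
    (measurableSet_steiner hB) (measurableSet_steiner hC)]
  refine lintegral_mono fun y => lintegral_mono fun y' => ?_
  exact sumTriple_real_le_centeredInterval (measurableSet_slice hA y) (measurableSet_slice hB y')
    (measurableSet_slice hC _) (hAf _) (hBf _) (hCf _)

lemma volume_centeredInterval_diff_add_le {X I : Set ℝ} {ρ : ℝ} (hI : I = centeredInterval ρ)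
    (hX : MeasurableSet X) (hXf : volume X ≠ ⊤) (s : ℝ) :
    volume (centeredInterval (volume X).toReal \ I) +
      volume ((I \ X) ∩ (fun x => x + s) ⁻¹' (X \ I)) ≤ volume (X \ I) := by
  have hIm : MeasurableSet I := hI ▸ measurableSet_centeredInterval ρ
  have hIf : volume I ≠ ⊤ := by rw [hI, volume_centeredInterval]; exact ENNReal.ofReal_ne_top
  rcases le_or_gt (volume X) (volume I) with h | h
  · have hsub : centeredInterval (volume X).toReal ⊆ I := by
      rw [hI, volume_centeredInterval] at h
      intro x hx
      have hx' : 2 * |x| < (volume X).toReal := hx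
      have hpos : 0 < (volume X).toReal := lt_of_le_of_lt (by positivity) hx'
      have hle : (volume X).toReal ≤ ρ := by
        have h3 := (ENNReal.toReal_le_toReal hXf ENNReal.ofReal_ne_top).2 h
        rw [ENNReal.toReal_ofReal'] at h3
        rcases le_max_iff.1 h3 with h4 | h4
        · exact h4
        · linarith
      rw [hI]
      exact lt_of_lt_of_le hx' hle
    rw [Set.sdiff_eq_empty.2 hsub, measure_empty, zero_add]
    calc _ ≤ volume ((fun x => x + s) ⁻¹' (X \ I)) := measure_mono Set.inter_subset_right
      _ = volume (X \ I) := measure_preimage_add_right _ _ _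
  · have hsub : I ⊆ centeredInterval (volume X).toReal := by
      rw [hI, volume_centeredInterval] at h
      rw [hI]
      intro x hx
      have hx' : 2 * |x| < ρ := hx
      refine lt_of_lt_of_le hx' ?_
      have h3 := (ENNReal.toReal_le_toReal ENNReal.ofReal_ne_top hXf).2 h.le
      rwa [ENNReal.toReal_ofReal (le_trans (by positivity) hx'.le)] at h3
    rw [measure_sdiff hsub hIm.nullMeasurableSet hIf, volume_centeredInterval,
      ENNReal.ofReal_toReal hXf]
    have e1 : volume (X ∩ I) + volume (X \ I) = volume X := measure_inter_add_sdiff X hIm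
    have e2 : volume (X ∩ I) + volume (I \ X) = volume I := by
      rw [Set.inter_comm]; exact measure_inter_add_sdiff I hX
    have hle : volume ((I \ X) ∩ (fun x => x + s) ⁻¹' (X \ I)) ≤ volume (I \ X) :=
      measure_mono Set.inter_subset_left
    refine (add_le_add_right hle _).trans ?_
    have hXIf : volume (X ∩ I) ≠ ⊤ := measure_ne_top_of_subset Set.inter_subset_left hXf
    rw [← ENNReal.add_le_add_iff_left hXIf, add_left_comm, e2, e1, tsub_add_cancel_of_le h.le]

lemma volume_steiner_diff_add_le [AddCommGroup F] [MeasurableAdd₂ F] {A I : Set (ℝ × F)}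
    (hA : MeasurableSet A) (hIm : MeasurableSet I)
    (hI : ∀ y, ∃ ρ, slice I y = centeredInterval ρ) (hAf : ∀ y, volume (slice A y) ≠ ⊤) (s : ℝ) :
    volume (steiner A \ I) + volume ((I \ A) ∩ (fun x => x + (s, 0)) ⁻¹' (A \ I)) ≤
      volume (A \ I) := by
  have := measurableAdd₂_prod (F := F)
  have hT : MeasurableSet ((I \ A) ∩ (fun x => x + (s, 0)) ⁻¹' (A \ I)) :=
    (hIm.diff hA).inter ((measurable_id.add_const _) (hA.diff hIm))
  rw [volume_eq_lintegral_slice ((measurableSet_steiner hA).diff hIm),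
    volume_eq_lintegral_slice hT, volume_eq_lintegral_slice (hA.diff hIm),
    ← lintegral_add_left (measurable_volume_slice ((measurableSet_steiner hA).diff hIm))]
  refine lintegral_mono fun y => ?_
  obtain ⟨ρ, hρ⟩ := hI y
  have := volume_centeredInterval_diff_add_le hρ (measurableSet_slice hA y) (hAf y) s
  refine le_trans (le_of_eq ?_) this
  congr 2
  ext t
  simp [slice]

end

/-- Orthonormal coordinates of Euclidean space that single out one direction. -/
structure SliceEquiv (n : ℕ) where
  toEquiv : EuclideanSpace ℝ (Fin (n + 1)) ≃ᵐ ℝ × (Fin n → ℝ)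
  map_add : ∀ x y, toEquiv (x + y) = toEquiv x + toEquiv y
  norm_sq : ∀ x, ‖x‖ ^ 2 = (toEquiv x).1 ^ 2 + ∑ i, (toEquiv x).2 i ^ 2
  measurePreserving : MeasurePreserving toEquiv volume volume

lemma exists_sliceEquiv {n : ℕ} (v : EuclideanSpace ℝ (Fin (n + 1))) (hv : v ≠ 0) :
    ∃ Ψ : SliceEquiv n, Ψ.toEquiv v = (‖v‖, 0) := by
  have hcard : Module.finrank ℝ (EuclideanSpace ℝ (Fin (n + 1))) = Fintype.card (Fin (n + 1)) := by
    simp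
  have hon : Orthonormal ℝ (Set.domRestrict ({0} : Set (Fin (n + 1)))
      (fun _ => (‖v‖⁻¹ : ℝ) • v)) := by
    constructor
    · intro i
      simp [norm_smul, hv]
    · rintro ⟨i, hi⟩ ⟨j, hj⟩ hij
      exact absurd (Subtype.ext (hi.trans hj.symm)) hij
  obtain ⟨b, hb⟩ := hon.exists_orthonormalBasis_extension_of_card_eq hcard
  have hb0 : b 0 = (‖v‖⁻¹ : ℝ) • v := hb 0 rfl
  have hv' : v = ‖v‖ • b 0 := by
    rw [hb0, smul_smul, mul_inv_cancel₀ (norm_ne_zero_iff.2 hv), one_smul]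
  have hrepr : b.repr v = ‖v‖ • EuclideanSpace.single 0 1 := by
    conv_lhs => rw [hv']
    rw [map_smul, b.repr_self]
  let e := b.repr.toHomeomorph.toMeasurableEquiv.trans
    ((MeasurableEquiv.toLp 2 (Fin (n + 1) → ℝ)).symm.trans
      (MeasurableEquiv.piFinSuccAbove (fun _ => ℝ) 0))
  have he : ∀ x, e x = (b.repr x 0, fun i => b.repr x i.succ) := fun x => rfl
  refine ⟨⟨e, fun x y => ?_, fun x => ?_, ?_⟩, ?_⟩
  · rw [he, he, he, map_add]
    rfl
  · rw [he, ← b.repr.norm_map x, EuclideanSpace.real_norm_sq_eq, Fin.sum_univ_succ]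
  · exact ((volume_preserving_piFinSuccAbove (fun _ => ℝ) 0).comp
      (PiLp.volume_preserving_ofLp (Fin (n + 1)))).comp b.measurePreserving_repr
  · change e v = _
    rw [he, hrepr]
    ext i
    · simp
    · simp

namespace SliceEquiv

variable {n : ℕ} (Ψ : SliceEquiv n)

/-- Steiner symmetrization along the singled out direction. -/
def symm (A : Set (EuclideanSpace ℝ (Fin (n + 1)))) : Set (EuclideanSpace ℝ (Fin (n + 1))) :=
  Ψ.toEquiv ⁻¹' steiner (Ψ.toEquiv.symm ⁻¹' A)

variable {A B C : Set (EuclideanSpace ℝ (Fin (n + 1)))}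

lemma measurableSet_symm (hA : MeasurableSet A) : MeasurableSet (Ψ.symm A) :=
  Ψ.toEquiv.measurable (measurableSet_steiner (Ψ.toEquiv.symm.measurable hA))

lemma slice_ball (r : ℝ) (y : Fin n → ℝ) :
    ∃ ρ, slice (Ψ.toEquiv.symm ⁻¹' Metric.ball 0 r) y = centeredInterval ρ := by
  rcases lt_or_ge r 0 with hr | hr
  · refine ⟨0, ?_⟩
    rw [Metric.ball_eq_empty.2 hr.le]
    ext t
    simp [slice, centeredInterval]
  · refine ⟨2 * √(r ^ 2 - ∑ i, y i ^ 2), ?_⟩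
    ext t
    have h := Ψ.norm_sq (Ψ.toEquiv.symm (t, y))
    rw [MeasurableEquiv.apply_symm_apply] at h
    change Ψ.toEquiv.symm (t, y) ∈ Metric.ball 0 r ↔ 2 * |t| < _
    rw [mem_ball_zero_iff, ← sq_lt_sq₀ (norm_nonneg _) hr, h, mul_lt_mul_iff_right₀ two_pos,
      Real.lt_sqrt (abs_nonneg t), sq_abs]
    constructor <;> intro h <;> simp only at * <;> linarith

lemma volume_slice_ne_top {R : ℝ} (hR : A ⊆ Metric.ball 0 R) (y : Fin n → ℝ) :
    volume (slice (Ψ.toEquiv.symm ⁻¹' A) y) ≠ ⊤ := by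
  obtain ⟨ρ, hρ⟩ := Ψ.slice_ball R y
  have hsub : slice (Ψ.toEquiv.symm ⁻¹' A) y ⊆ centeredInterval ρ := by
    rw [← hρ]
    exact fun t ht => hR ht
  refine measure_ne_top_of_subset hsub ?_
  rw [volume_centeredInterval]
  exact ENNReal.ofReal_ne_top

lemma volume_preimage_symm (hA : MeasurableSet A) :
    volume (Ψ.toEquiv.symm ⁻¹' A) = volume A :=
  Ψ.measurePreserving.symm.measure_preimage hA.nullMeasurableSet

lemma volume_symm {R : ℝ} (hA : MeasurableSet A) (hR : A ⊆ Metric.ball 0 R) :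
    volume (Ψ.symm A) = volume A := by
  have hA' := Ψ.toEquiv.symm.measurable hA
  rw [symm, Ψ.measurePreserving.measure_preimage (measurableSet_steiner hA').nullMeasurableSet,
    volume_steiner hA' (Ψ.volume_slice_ne_top hR), Ψ.volume_preimage_symm hA]

lemma symm_subset_ball {R : ℝ} (hR : A ⊆ Metric.ball 0 R) : Ψ.symm A ⊆ Metric.ball 0 R := by
  intro x hx
  obtain ⟨ρ, hρ⟩ := Ψ.slice_ball R (Ψ.toEquiv x).2
  have hsub : slice (Ψ.toEquiv.symm ⁻¹' A) (Ψ.toEquiv x).2 ⊆ centeredInterval ρ := by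
    rw [← hρ]
    exact fun t ht => hR ht
  have hx' : 2 * |(Ψ.toEquiv x).1| <
    (volume (slice (Ψ.toEquiv.symm ⁻¹' A) (Ψ.toEquiv x).2)).toReal := hx
  have hle := ENNReal.toReal_mono (by rw [volume_centeredInterval]; exact ENNReal.ofReal_ne_top)
    (measure_mono (μ := volume) hsub)
  rw [volume_centeredInterval, ENNReal.toReal_ofReal'] at hle
  have hρ' : 2 * |(Ψ.toEquiv x).1| < ρ := by
    rcases lt_max_iff.1 (hx'.trans_le hle) with h | h
    · exact h
    · exact absurd h (not_lt.2 (by positivity))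
  have : (Ψ.toEquiv x).1 ∈ slice (Ψ.toEquiv.symm ⁻¹' Metric.ball 0 R) (Ψ.toEquiv x).2 := by
    rw [hρ]; exact hρ'
  simpa [slice] using this

lemma volume_symm_diff_add_le {R : ℝ} (hA : MeasurableSet A) (hR : A ⊆ Metric.ball 0 R) (r : ℝ)
    {v : EuclideanSpace ℝ (Fin (n + 1))} {s : ℝ} (hv : Ψ.toEquiv v = (s, 0)) :
    volume (Ψ.symm A \ Metric.ball 0 r) +
      volume ((Metric.ball 0 r \ A) ∩ (fun x => x + v) ⁻¹' (A \ Metric.ball 0 r)) ≤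
      volume (A \ Metric.ball 0 r) := by
  have hA' := Ψ.toEquiv.symm.measurable hA
  have hI' := Ψ.toEquiv.symm.measurable (measurableSet_ball (x := 0) (ε := r))
  have key := volume_steiner_diff_add_le hA' hI' (Ψ.slice_ball r) (Ψ.volume_slice_ne_top hR) s
  have hdiff : volume (Ψ.toEquiv.symm ⁻¹' A \ Ψ.toEquiv.symm ⁻¹' Metric.ball 0 r) =
      volume (A \ Metric.ball 0 r) := by
    rw [← Set.preimage_sdiff, Ψ.volume_preimage_symm (hA.diff measurableSet_ball)]
  rw [hdiff] at key
  refine le_trans (le_of_eq ?_) key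
  have := measurableAdd₂_prod (F := Fin n → ℝ)
  congr 1
  · rw [← Ψ.measurePreserving.measure_preimage
      ((measurableSet_steiner hA').diff hI').nullMeasurableSet]
    congr 1
    ext x
    simp [symm]
  · have hT : MeasurableSet ((fun x => x + ((s, 0) : ℝ × (Fin n → ℝ))) ⁻¹'
        (Ψ.toEquiv.symm ⁻¹' A \ Ψ.toEquiv.symm ⁻¹' Metric.ball 0 r)) :=
      (measurable_add_const _) (hA'.diff hI')
    rw [← Ψ.measurePreserving.measure_preimage ((hI'.diff hA').inter hT).nullMeasurableSet]
    congr 1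
    ext x
    have : Ψ.toEquiv.symm (Ψ.toEquiv x + (s, 0)) = x + v := by
      rw [← hv, ← Ψ.map_add, MeasurableEquiv.symm_apply_apply]
    simp only [Set.mem_inter_iff, Set.mem_preimage, Set.mem_sdiff,
      MeasurableEquiv.symm_apply_apply, this]

lemma volume_preimage_prod (S : Set ((ℝ × (Fin n → ℝ)) × (ℝ × (Fin n → ℝ))))
    (hS : MeasurableSet S) :
    volume ((fun p : EuclideanSpace ℝ (Fin (n + 1)) × EuclideanSpace ℝ (Fin (n + 1)) =>
      (Ψ.toEquiv p.1, Ψ.toEquiv p.2)) ⁻¹' S) = volume S :=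
  (Ψ.measurePreserving.prod Ψ.measurePreserving).measure_preimage hS.nullMeasurableSet

lemma sumTriple_eq (hA : MeasurableSet A) (hB : MeasurableSet B) (hC : MeasurableSet C) :
    sumTriple A B C = sumTriple (Ψ.toEquiv.symm ⁻¹' A) (Ψ.toEquiv.symm ⁻¹' B)
      (Ψ.toEquiv.symm ⁻¹' C) := by
  have := measurableAdd₂_prod (F := Fin n → ℝ)
  conv_rhs => rw [sumTriple]
  rw [← Ψ.volume_preimage_prod _ (measurableSet_sumTriple (Ψ.toEquiv.symm.measurable hA)
    (Ψ.toEquiv.symm.measurable hB) (Ψ.toEquiv.symm.measurable hC)), sumTriple]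
  congr 1
  ext p
  simp [← Ψ.map_add]

lemma sumTriple_le_symm {R : ℝ} (hA : MeasurableSet A) (hB : MeasurableSet B)
    (hC : MeasurableSet C) (hAR : A ⊆ Metric.ball 0 R) (hBR : B ⊆ Metric.ball 0 R)
    (hCR : C ⊆ Metric.ball 0 R) :
    sumTriple A B C ≤ sumTriple (Ψ.symm A) (Ψ.symm B) (Ψ.symm C) := by
  have h : ∀ D, Ψ.toEquiv.symm ⁻¹' Ψ.symm D = steiner (Ψ.toEquiv.symm ⁻¹' D) := by
    intro D
    ext x
    simp [symm]
  rw [Ψ.sumTriple_eq hA hB hC, Ψ.sumTriple_eq (Ψ.measurableSet_symm hA) (Ψ.measurableSet_symm hB)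
    (Ψ.measurableSet_symm hC), h, h, h]
  exact sumTriple_le_steiner (Ψ.toEquiv.symm.measurable hA) (Ψ.toEquiv.symm.measurable hB)
    (Ψ.toEquiv.symm.measurable hC) (Ψ.volume_slice_ne_top hAR) (Ψ.volume_slice_ne_top hBR)
    (Ψ.volume_slice_ne_top hCR)

end SliceEquiv

section BallStar

variable {n : ℕ} {A B : Set (EuclideanSpace ℝ (Fin (n + 1)))}

lemma symmRadius_nonneg {d : ℕ} (A : Set (EuclideanSpace ℝ (Fin d))) : 0 ≤ symmRadius A :=
  Real.rpow_nonneg ENNReal.toReal_nonneg _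

lemma measurableSet_ballStar {d : ℕ} (A : Set (EuclideanSpace ℝ (Fin d))) :
    MeasurableSet (ballStar A) := measurableSet_ball

lemma volume_unit_ball_ne_zero {d : ℕ} :
    volume (Metric.ball (0 : EuclideanSpace ℝ (Fin d)) 1) ≠ 0 :=
  (Metric.measure_ball_pos volume _ one_pos).ne'

lemma volume_unit_ball_ne_top {d : ℕ} :
    volume (Metric.ball (0 : EuclideanSpace ℝ (Fin d)) 1) ≠ ⊤ := measure_ball_lt_top.ne

lemma volume_ballStar (hA : volume A ≠ ⊤) : volume (ballStar A) = volume A := by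
  rw [ballStar, Measure.addHaar_ball _ _ (symmRadius_nonneg A), finrank_euclideanSpace_fin,
    symmRadius, ← Real.rpow_natCast, ← Real.rpow_mul ENNReal.toReal_nonneg]
  rw [one_div, inv_mul_cancel₀ (by positivity), Real.rpow_one, ENNReal.ofReal_toReal
    (ENNReal.div_ne_top hA volume_unit_ball_ne_zero),
    ENNReal.div_mul_cancel volume_unit_ball_ne_zero volume_unit_ball_ne_top]

lemma symmRadius_mono (hB : volume B ≠ ⊤) (h : volume A ≤ volume B) :
    symmRadius A ≤ symmRadius B := by
  unfold symmRadius
  gcongr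
  exact ENNReal.div_ne_top hB volume_unit_ball_ne_zero

lemma ballStar_mono (hB : volume B ≠ ⊤) (h : volume A ≤ volume B) : ballStar A ⊆ ballStar B :=
  Metric.ball_subset_ball (symmRadius_mono hB h)

lemma ballStar_congr (h : volume A = volume B) : ballStar A = ballStar B := by
  unfold ballStar symmRadius
  rw [h]

lemma symmRadius_ball {R : ℝ} (hR : 0 ≤ R) :
    symmRadius (Metric.ball (0 : EuclideanSpace ℝ (Fin (n + 1))) R) = R := by
  rw [symmRadius, Measure.addHaar_ball _ _ hR, finrank_euclideanSpace_fin,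
    ENNReal.mul_div_cancel_right volume_unit_ball_ne_zero volume_unit_ball_ne_top,
    ENNReal.toReal_ofReal (by positivity), ← Real.rpow_natCast, ← Real.rpow_mul hR]
  rw [mul_one_div_cancel (by positivity), Real.rpow_one]

lemma ballStar_subset_ball {R : ℝ} (hAR : A ⊆ Metric.ball 0 R) : ballStar A ⊆ Metric.ball 0 R := by
  rcases lt_or_ge R 0 with hR | hR
  · rw [Metric.ball_eq_empty.2 hR.le] at hAR ⊢
    rw [Set.subset_empty_iff.1 hAR]
    simp [ballStar, symmRadius, Real.zero_rpow (show ((n : ℝ) + 1)⁻¹ ≠ 0 by positivity)]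
  · refine (ballStar_mono measure_ball_lt_top.ne (measure_mono hAR)).trans ?_
    rw [ballStar, symmRadius_ball hR]

lemma volume_ballStar_diff (hAm : MeasurableSet A) (hA : volume A ≠ ⊤) :
    volume (ballStar A \ A) = volume (A \ ballStar A) := by
  have e1 := measure_inter_add_sdiff (μ := volume) A (measurableSet_ballStar A)
  have e2 := measure_inter_add_sdiff (μ := volume) (ballStar A) hAm
  rw [volume_ballStar hA, ← e1, Set.inter_comm] at e2
  exact (ENNReal.add_right_inj (measure_ne_top_of_subset Set.inter_subset_left hA)).1 e2

end BallStar

lemma lintegral_volume_inter_translate {n : ℕ} {P Q : Set (EuclideanSpace ℝ (Fin (n + 1)))}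
    (hP : MeasurableSet P) (hQ : MeasurableSet Q) :
    ∫⁻ v, volume (P ∩ (fun x => x + v) ⁻¹' Q) = volume P * volume Q := by
  rw [← Measure.prod_prod, ← (measurePreserving_prod_add volume volume).measure_preimage
    (hP.prod hQ).nullMeasurableSet, Measure.prod_apply_symm]
  · rfl
  · exact (measurable_fst.prodMk (measurable_fst.add measurable_snd)) (hP.prod hQ)

lemma exists_lt_volume_inter_translate {n : ℕ} {P Q : Set (EuclideanSpace ℝ (Fin (n + 1)))}
    (hP : MeasurableSet P) (hQ : MeasurableSet Q) {R : ℝ} (hPR : P ⊆ Metric.ball 0 R)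
    (hQR : Q ⊆ Metric.ball 0 R) {κ : ℝ≥0∞}
    (hκ : κ * volume (Metric.ball (0 : EuclideanSpace ℝ (Fin (n + 1))) (R + R)) <
      volume P * volume Q) : ∃ v, κ < volume (P ∩ (fun x => x + v) ⁻¹' Q) := by
  by_contra! h
  refine hκ.not_ge ?_
  rw [← lintegral_volume_inter_translate hP hQ, ← setLIntegral_const,
    ← lintegral_indicator measurableSet_ball]
  refine lintegral_mono fun v => ?_
  by_cases hv : v ∈ Metric.ball 0 (R + R)
  · rw [Set.indicator_of_mem hv]
    exact h v
  · have : P ∩ (fun x => x + v) ⁻¹' Q = ∅ := by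
      rw [Set.eq_empty_iff_forall_notMem]
      rintro x ⟨hx, hxv⟩
      have h1 := mem_ball_zero_iff.1 (hPR hx)
      have h2 := mem_ball_zero_iff.1 (hQR hxv)
      refine hv (mem_ball_zero_iff.2 ?_)
      calc ‖v‖ = ‖(x + v) - x‖ := by congr 1; abel
        _ ≤ ‖x + v‖ + ‖x‖ := norm_sub_le _ _
        _ < R + R := add_lt_add h2 h1
    simp [this]

lemma exists_symm_improve {n : ℕ} (R : ℝ) {ε : ℝ≥0∞} (hε : ε ≠ 0) : ∃ κ : ℝ≥0∞, κ ≠ 0 ∧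
    ∀ A : Fin 3 → Set (EuclideanSpace ℝ (Fin (n + 1))), (∀ i, MeasurableSet (A i)) →
      (∀ i, A i ⊆ Metric.ball 0 R) → ε < ∑ i, volume (A i \ ballStar (A i)) →
      ∃ Ψ : SliceEquiv n, ∑ i, volume (Ψ.symm (A i) \ ballStar (Ψ.symm (A i))) + κ ≤
        ∑ i, volume (A i \ ballStar (A i)) := by
  obtain ⟨M, hM⟩ : ∃ M, M = volume (Metric.ball (0 : EuclideanSpace ℝ (Fin (n + 1))) (R + R)) :=
    ⟨_, rfl⟩
  have hMtop : M + 1 ≠ ⊤ := by rw [hM]; exact ENNReal.add_ne_top.2 ⟨measure_ball_lt_top.ne, by simp⟩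
  refine ⟨(ε / 3) ^ 2 / (M + 1), ?_, fun A hA hAR hlt => ?_⟩
  · exact ENNReal.div_ne_zero.2 ⟨pow_ne_zero 2 (ENNReal.div_ne_zero.2 ⟨hε, by simp⟩), hMtop⟩
  obtain ⟨i, hi⟩ : ∃ i, ε / 3 < volume (A i \ ballStar (A i)) := by
    by_contra! h
    refine hlt.not_ge ?_
    rw [Fin.sum_univ_three]
    calc _ ≤ ε / 3 + ε / 3 + ε / 3 := by gcongr <;> exact h _
      _ = ε := ENNReal.add_thirds ε
  have hfin : ∀ i, volume (A i) ≠ ⊤ := fun i =>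
    measure_ne_top_of_subset (hAR i) measure_ball_lt_top.ne
  have hP := (measurableSet_ballStar (A i)).diff (hA i)
  have hQ := (hA i).diff (measurableSet_ballStar (A i))
  obtain ⟨v, hv⟩ := exists_lt_volume_inter_translate hP hQ
    (Set.sdiff_subset.trans (ballStar_subset_ball (hAR i))) (Set.sdiff_subset.trans (hAR i))
    (κ := (ε / 3) ^ 2 / (M + 1)) (by
      rw [← hM, volume_ballStar_diff (hA i) (hfin i), ← sq]
      calc (ε / 3) ^ 2 / (M + 1) * M ≤ (ε / 3) ^ 2 / (M + 1) * (M + 1) := by gcongr; simp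
        _ ≤ (ε / 3) ^ 2 := by rw [mul_comm]; exact ENNReal.mul_div_le
        _ < _ := ENNReal.pow_lt_pow_left two_ne_zero hi)
  have hv0 : v ≠ 0 := by
    rintro rfl
    have : (ballStar (A i) \ A i) ∩ (fun x => x + 0) ⁻¹' (A i \ ballStar (A i)) = ∅ := by
      rw [Set.eq_empty_iff_forall_notMem]
      rintro x ⟨h1, h2⟩
      simp only [add_zero, Set.preimage_id'] at h2
      exact h1.2 h2.1
    rw [this] at hv
    simp at hv
  obtain ⟨Ψ, hΨ⟩ := exists_sliceEquiv v hv0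
  refine ⟨Ψ, ?_⟩
  have hstep : ∀ j, volume (Ψ.symm (A j) \ ballStar (Ψ.symm (A j))) +
      volume ((ballStar (A j) \ A j) ∩ (fun x => x + v) ⁻¹' (A j \ ballStar (A j))) ≤
      volume (A j \ ballStar (A j)) := by
    intro j
    rw [ballStar_congr (Ψ.volume_symm (hA j) (hAR j))]
    exact Ψ.volume_symm_diff_add_le (hA j) (hAR j) _ hΨ
  refine le_trans ?_ (Finset.sum_le_sum fun j _ => hstep j)
  rw [Finset.sum_add_distrib]
  gcongr
  refine hv.le.trans ?_
  exact Finset.single_le_sum (f := fun j => volume ((ballStar (A j) \ A j) ∩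
    (fun x => x + v) ⁻¹' (A j \ ballStar (A j)))) (fun _ _ => zero_le) (Finset.mem_univ i)

lemma sumTriple_le_ballStar_add {n : ℕ} {R : ℝ}
    {A : Fin 3 → Set (EuclideanSpace ℝ (Fin (n + 1)))} (hA : ∀ i, MeasurableSet (A i))
    (hAR : ∀ i, A i ⊆ Metric.ball 0 R) :
    sumTriple (A 0) (A 1) (A 2) ≤ sumTriple (ballStar (A 0)) (ballStar (A 1)) (ballStar (A 2)) +
      volume (Metric.ball (0 : EuclideanSpace ℝ (Fin (n + 1))) R) *
        ∑ i, volume (A i \ ballStar (A i)) := by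
  have hsub : {p : EuclideanSpace ℝ (Fin (n + 1)) × EuclideanSpace ℝ (Fin (n + 1)) |
      p.1 ∈ A 0 ∧ p.2 ∈ A 1 ∧ p.1 + p.2 ∈ A 2} ⊆
      {p | p.1 ∈ ballStar (A 0) ∧ p.2 ∈ ballStar (A 1) ∧ p.1 + p.2 ∈ ballStar (A 2)} ∪
      ({p | p.1 ∈ A 0 \ ballStar (A 0) ∧ p.2 ∈ A 1 ∧ p.1 + p.2 ∈ A 2} ∪
      ({p | p.1 ∈ A 0 ∧ p.2 ∈ A 1 \ ballStar (A 1) ∧ p.1 + p.2 ∈ A 2} ∪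
      {p | p.1 ∈ A 0 ∧ p.2 ∈ A 1 ∧ p.1 + p.2 ∈ A 2 \ ballStar (A 2)})) := by
    rintro p ⟨h0, h1, h2⟩
    by_cases g0 : p.1 ∈ ballStar (A 0)
    · by_cases g1 : p.2 ∈ ballStar (A 1)
      · by_cases g2 : p.1 + p.2 ∈ ballStar (A 2)
        · exact Or.inl ⟨g0, g1, g2⟩
        · exact Or.inr (Or.inr (Or.inr ⟨h0, h1, h2, g2⟩))
      · exact Or.inr (Or.inr (Or.inl ⟨h0, ⟨h1, g1⟩, h2⟩))
    · exact Or.inr (Or.inl ⟨⟨h0, g0⟩, h1, h2⟩)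
  have hm : ∀ i, MeasurableSet (A i \ ballStar (A i)) := fun i =>
    (hA i).diff (measurableSet_ballStar _)
  refine (measure_mono hsub).trans ((measure_union_le _ _).trans ?_)
  refine add_le_add le_rfl ((measure_union_le _ _).trans ?_)
  rw [Fin.sum_univ_three, add_assoc, mul_add, mul_add]
  refine add_le_add ?_ ((measure_union_le _ _).trans (add_le_add ?_ ?_))
  · refine (sumTriple_le_left _ _ _).trans ?_
    rw [mul_comm]
    gcongr
    exact hAR 1
  · refine (sumTriple_le_left _ _ _).trans ?_
    gcongr
    exact hAR 0
  · refine (sumTriple_le_mid (hA 0) (hm 2)).trans ?_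
    gcongr
    exact hAR 0

lemma sumTriple_le_ballStar_of_subset_ball {n : ℕ} {R : ℝ}
    {A : Fin 3 → Set (EuclideanSpace ℝ (Fin (n + 1)))} (hA : ∀ i, MeasurableSet (A i))
    (hAR : ∀ i, A i ⊆ Metric.ball 0 R) :
    sumTriple (A 0) (A 1) (A 2) ≤ sumTriple (ballStar (A 0)) (ballStar (A 1)) (ballStar (A 2)) := by
  obtain ⟨M, hM⟩ : ∃ M, M = volume (Metric.ball (0 : EuclideanSpace ℝ (Fin (n + 1))) R) := ⟨_, rfl⟩
  have hMtop : M ≠ ⊤ := by rw [hM]; exact measure_ball_lt_top.ne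
  have key : ∀ ε : ℝ≥0∞, ε ≠ 0 → sumTriple (A 0) (A 1) (A 2) ≤
      sumTriple (ballStar (A 0)) (ballStar (A 1)) (ballStar (A 2)) + M * ε := by
    intro ε hε
    obtain ⟨κ, hκ, himp⟩ := exists_symm_improve (n := n) R hε
    have hind : ∀ N : ℕ, ∀ A : Fin 3 → Set (EuclideanSpace ℝ (Fin (n + 1))),
        (∀ i, MeasurableSet (A i)) → (∀ i, A i ⊆ Metric.ball 0 R) →
        ∑ i, volume (A i \ ballStar (A i)) ≤ ε + N * κ → sumTriple (A 0) (A 1) (A 2) ≤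
          sumTriple (ballStar (A 0)) (ballStar (A 1)) (ballStar (A 2)) + M * ε := by
      intro N
      induction N with
      | zero =>
        intro A hA hAR hle
        refine (sumTriple_le_ballStar_add hA hAR).trans ?_
        rw [← hM]
        gcongr
        simpa using hle
      | succ N ih =>
        intro A hA hAR hle
        rcases le_or_gt (∑ i, volume (A i \ ballStar (A i))) ε with h | h
        · refine (sumTriple_le_ballStar_add hA hAR).trans ?_
          rw [← hM]
          gcongr
        · obtain ⟨Ψ, hΨ⟩ := himp A hA hAR h
          have hsumtop : ∑ i, volume (A i \ ballStar (A i)) ≠ ⊤ :=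
            ENNReal.sum_ne_top.2 fun i _ => measure_ne_top_of_subset
              (Set.sdiff_subset.trans (hAR i)) measure_ball_lt_top.ne
          have hκtop : κ ≠ ⊤ := ne_top_of_le_ne_top hsumtop (le_add_self.trans hΨ)
          have := ih (fun i => Ψ.symm (A i)) (fun i => Ψ.measurableSet_symm (hA i))
            (fun i => Ψ.symm_subset_ball (hAR i)) (by
              rw [← ENNReal.add_le_add_iff_right hκtop]
              refine (hΨ.trans hle).trans (le_of_eq ?_)
              push_cast
              ring)
          refine (Ψ.sumTriple_le_symm (hA 0) (hA 1) (hA 2) (hAR 0) (hAR 1) (hAR 2)).trans ?_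
          simpa only [ballStar_congr (Ψ.volume_symm (hA _) (hAR _))] using this
    obtain ⟨N, hN⟩ := ENNReal.exists_nat_mul_gt hκ
      (b := ∑ i, volume (A i \ ballStar (A i))) (ENNReal.sum_ne_top.2 fun i _ =>
        measure_ne_top_of_subset (Set.sdiff_subset.trans (hAR i)) measure_ball_lt_top.ne)
    exact hind N A hA hAR (hN.le.trans le_add_self)
  refine ENNReal.le_of_forall_pos_le_add fun ε hε _ => ?_
  have hε' : (ε : ℝ≥0∞) ≠ 0 := by simpa using hε.ne'
  refine (key (ε / (M + 1)) (ENNReal.div_ne_zero.2 ⟨hε', by simp [hMtop]⟩)).trans ?_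
  gcongr
  calc M * (ε / (M + 1)) ≤ (M + 1) * (ε / (M + 1)) := by gcongr; simp
    _ ≤ ε := ENNReal.mul_div_le

/-- **Riesz rearrangement inequality** for three sets. -/
theorem sumTriple_le_ballStar {n : ℕ} {A B C : Set (EuclideanSpace ℝ (Fin (n + 1)))}
    (hA : MeasurableSet A) (hB : MeasurableSet B) (hC : MeasurableSet C) (hAf : volume A ≠ ⊤)
    (hBf : volume B ≠ ⊤) (hCf : volume C ≠ ⊤) :
    sumTriple A B C ≤ sumTriple (ballStar A) (ballStar B) (ballStar C) := by
  have hU : {p : EuclideanSpace ℝ (Fin (n + 1)) × EuclideanSpace ℝ (Fin (n + 1)) |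
      p.1 ∈ A ∧ p.2 ∈ B ∧ p.1 + p.2 ∈ C} =
      ⋃ N : ℕ, {p | p.1 ∈ A ∩ Metric.ball 0 N ∧ p.2 ∈ B ∩ Metric.ball 0 N ∧
        p.1 + p.2 ∈ C ∩ Metric.ball 0 N} := by
    ext p
    simp only [Set.mem_iUnion]
    constructor
    · rintro ⟨h1, h2, h3⟩
      obtain ⟨N, hN⟩ := exists_nat_gt (max ‖p.1‖ (max ‖p.2‖ ‖p.1 + p.2‖))
      simp only [max_lt_iff] at hN
      exact ⟨N, ⟨h1, mem_ball_zero_iff.2 hN.1⟩, ⟨h2, mem_ball_zero_iff.2 hN.2.1⟩,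
        ⟨h3, mem_ball_zero_iff.2 hN.2.2⟩⟩
    · rintro ⟨N, h1, h2, h3⟩
      exact ⟨h1.1, h2.1, h3.1⟩
  rw [sumTriple, hU, Monotone.measure_iUnion]
  · refine iSup_le fun N => ?_
    refine (sumTriple_le_ballStar_of_subset_ball (R := N)
      (A := ![A ∩ Metric.ball 0 N, B ∩ Metric.ball 0 N, C ∩ Metric.ball 0 N]) ?_ ?_).trans ?_
    · intro i
      fin_cases i
      exacts [hA.inter measurableSet_ball, hB.inter measurableSet_ball,
        hC.inter measurableSet_ball]
    · intro i
      fin_cases i <;> exact Set.inter_subset_right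
    · exact sumTriple_mono (ballStar_mono hAf (measure_mono Set.inter_subset_left))
        (ballStar_mono hBf (measure_mono Set.inter_subset_left))
        (ballStar_mono hCf (measure_mono Set.inter_subset_left))
  · intro N N' hN p hp
    have hsub := Metric.ball_subset_ball (x := (0 : EuclideanSpace ℝ (Fin (n + 1))))
      (Nat.cast_le (α := ℝ).2 hN)
    exact ⟨⟨hp.1.1, hsub hp.1.2⟩, ⟨hp.2.1.1, hsub hp.2.1.2⟩, ⟨hp.2.2.1, hsub hp.2.2.2⟩⟩

section LayerCake

variable {α : Type*} [MeasurableSpace α] {μ : Measure α} [SFinite μ]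

lemma setLIntegral_Ioi_indicator_ofReal_lt (a : ℝ≥0∞) :
    ∫⁻ t in Set.Ioi (0 : ℝ), {t : ℝ | ENNReal.ofReal t < a}.indicator (fun _ => (1 : ℝ≥0∞)) t =
      a := by
  have hm : MeasurableSet {t : ℝ | ENNReal.ofReal t < a} :=
    measurableSet_lt ENNReal.measurable_ofReal measurable_const
  rw [lintegral_indicator hm, Measure.restrict_restrict hm, lintegral_one,
    Measure.restrict_apply_univ]
  induction a with
  | top =>
    have : {t : ℝ | ENNReal.ofReal t < ⊤} = Set.univ := by ext; simp
    rw [this, Set.univ_inter, Real.volume_Ioi]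
  | coe a =>
    have : {t : ℝ | ENNReal.ofReal t < a} ∩ Set.Ioi 0 = Set.Ioo 0 (a : ℝ) := by
      ext t
      simp only [Set.mem_inter_iff, Set.mem_ofPred_eq, Set.mem_Ioi, Set.mem_Ioo]
      refine ⟨fun h => ⟨h.2, ?_⟩, fun h => ⟨?_, h.1⟩⟩
      · have := (ENNReal.ofReal_lt_iff_lt_toReal h.2.le ENNReal.coe_ne_top).1 h.1
        simpa using this
      · exact (ENNReal.ofReal_lt_iff_lt_toReal h.1.le ENNReal.coe_ne_top).2 (by simpa using h.2)
    rw [this, Real.volume_Ioo, sub_zero, ENNReal.ofReal_coe_nnreal]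

lemma lintegral_mul_eq_lintegral_superlevel {g V : α → ℝ≥0∞} (hg : Measurable g)
    (hV : Measurable V) :
    ∫⁻ x, g x * V x ∂μ =
      ∫⁻ t in Set.Ioi (0 : ℝ), ∫⁻ x in {x | ENNReal.ofReal t < g x}, V x ∂μ := by
  have hs : MeasurableSet {p : ℝ × α | ENNReal.ofReal p.1 < g p.2} :=
    measurableSet_lt (ENNReal.measurable_ofReal.comp measurable_fst) (hg.comp measurable_snd)
  have h1 : ∀ t : ℝ, ∫⁻ x in {x | ENNReal.ofReal t < g x}, V x ∂μ =
      ∫⁻ x, {p : ℝ × α | ENNReal.ofReal p.1 < g p.2}.indicator (fun p => V p.2) (t, x) ∂μ :=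
    fun t => (lintegral_indicator (measurableSet_lt measurable_const hg) _).symm
  simp_rw [h1]
  rw [lintegral_lintegral_swap (f := fun t x => {p : ℝ × α | ENNReal.ofReal p.1 < g p.2}.indicator
    (fun p => V p.2) (t, x)) ((hV.comp measurable_snd).indicator hs).aemeasurable]
  refine lintegral_congr fun x => ?_
  conv_lhs => rw [← setLIntegral_Ioi_indicator_ofReal_lt (g x)]
  rw [← lintegral_mul_const'' _ (measurable_const.indicator
    (measurableSet_lt ENNReal.measurable_ofReal measurable_const)).aemeasurable]
  refine lintegral_congr fun t => ?_
  by_cases h : ENNReal.ofReal t < g x <;> simp [Set.indicator, h]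

lemma lintegral_eq_lintegral_superlevel {g : α → ℝ≥0∞} (hg : Measurable g) :
    ∫⁻ x, g x ∂μ = ∫⁻ t in Set.Ioi (0 : ℝ), μ {x | ENNReal.ofReal t < g x} := by
  simpa using lintegral_mul_eq_lintegral_superlevel hg (V := fun _ => 1) measurable_const (μ := μ)

lemma lintegral_ofReal_mul_eq {f : α → ℝ} (hf : Measurable f) {V : α → ℝ≥0∞} (hV : Measurable V) :
    ∫⁻ x, ENNReal.ofReal (f x) * V x ∂μ =
      ∫⁻ t in Set.Ioi (0 : ℝ), ∫⁻ x in {x | t < f x}, V x ∂μ := by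
  rw [lintegral_mul_eq_lintegral_superlevel hf.ennreal_ofReal hV]
  refine setLIntegral_congr_fun measurableSet_Ioi fun t ht => ?_
  have : {x | ENNReal.ofReal t < ENNReal.ofReal (f x)} = {x | t < f x} := by
    ext x
    exact ENNReal.ofReal_lt_ofReal_iff_of_nonneg (le_of_lt ht)
  simp only [this]

end LayerCake

section Rearrange

variable {d : ℕ}

lemma measurable_symmRadius_superlevel (f : EuclideanSpace ℝ (Fin d) → ℝ) :
    Measurable fun t : ℝ => symmRadius {y | t < f y} := by
  have h : Antitone fun t : ℝ => volume {y : EuclideanSpace ℝ (Fin d) | t < f y} :=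
    fun s t hst => measure_mono fun y hy => lt_of_le_of_lt hst hy
  exact ((h.measurable.div_const _).ennreal_toReal).pow_const _

lemma measurableSet_ballStar_superlevel (f : EuclideanSpace ℝ (Fin d) → ℝ) :
    MeasurableSet {p : ℝ × EuclideanSpace ℝ (Fin d) | p.2 ∈ ballStar {y | p.1 < f y}} := by
  have : {p : ℝ × EuclideanSpace ℝ (Fin d) | p.2 ∈ ballStar {y | p.1 < f y}} =
      {p | ‖p.2‖ < symmRadius {y | p.1 < f y}} := by
    ext p
    simp [ballStar]
  rw [this]
  exact measurableSet_lt measurable_snd.norm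
    ((measurable_symmRadius_superlevel f).comp measurable_fst)

lemma measurable_symmRearrange (f : EuclideanSpace ℝ (Fin d) → ℝ) :
    Measurable (symmRearrange f) := by
  have h : Measurable ({p : ℝ × EuclideanSpace ℝ (Fin d) |
      p.2 ∈ ballStar {y | p.1 < f y}}.indicator fun _ => (1 : ℝ≥0∞)) :=
    measurable_const.indicator (measurableSet_ballStar_superlevel f)
  exact h.lintegral_prod_left'

lemma lintegral_symmRearrange_mul_eq {μ : Measure (EuclideanSpace ℝ (Fin d))} [SFinite μ]
    (f : EuclideanSpace ℝ (Fin d) → ℝ) {W : EuclideanSpace ℝ (Fin d) → ℝ≥0∞} (hW : Measurable W) :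
    ∫⁻ x, symmRearrange f x * W x ∂μ =
      ∫⁻ t in Set.Ioi (0 : ℝ), ∫⁻ x in ballStar {y | t < f y}, W x ∂μ := by
  obtain ⟨S, hSdef⟩ : ∃ S,
      S = {p : ℝ × EuclideanSpace ℝ (Fin d) | p.2 ∈ ballStar {y | p.1 < f y}} :=
    ⟨_, rfl⟩
  have hS : MeasurableSet S := hSdef ▸ measurableSet_ballStar_superlevel f
  have hmem : ∀ t x, (t, x) ∈ S ↔ x ∈ ballStar {y | t < f y} := fun t x => by rw [hSdef]; rfl
  have h1 : ∀ t : ℝ, ∫⁻ x in ballStar {y | t < f y}, W x ∂μ =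
      ∫⁻ x, S.indicator (fun p => W p.2) (t, x) ∂μ := by
    intro t
    rw [← lintegral_indicator (measurableSet_ballStar _)]
    refine lintegral_congr fun x => ?_
    by_cases h : x ∈ ballStar {y | t < f y} <;> simp [hmem, h]
  have h2 : ∀ x, symmRearrange f x =
      ∫⁻ t in Set.Ioi (0 : ℝ), S.indicator (fun _ => (1 : ℝ≥0∞)) (t, x) := by
    intro x
    rw [symmRearrange]
    refine lintegral_congr fun t => ?_
    by_cases h : x ∈ ballStar {y | t < f y} <;> simp [hmem, h]
  simp_rw [h1, h2]
  rw [lintegral_lintegral_swap (f := fun t x => S.indicator (fun p => W p.2) (t, x))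
    ((hW.comp measurable_snd).indicator hS).aemeasurable]
  refine lintegral_congr fun x => ?_
  have hm : Measurable fun t => S.indicator (fun _ => (1 : ℝ≥0∞)) (t, x) :=
    (measurable_const.indicator hS).comp measurable_prodMk_right
  rw [← lintegral_mul_const _ hm]
  refine lintegral_congr fun t => ?_
  by_cases h : (t, x) ∈ S <;> simp [h]

end Rearrange

/-- `V` is less concentrated than `W`: its integral over any set of finite volume is at most
the integral of `W` over the centered ball of the same volume. -/
def LessConcentrated {d : ℕ} (V W : EuclideanSpace ℝ (Fin d) → ℝ≥0∞) : Prop :=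
  ∀ C, MeasurableSet C → volume C ≠ ⊤ → ∫⁻ y in C, V y ≤ ∫⁻ y in ballStar C, W y

/-- `W` is a decreasing function of the norm. -/
def RadiallyDecreasing {d : ℕ} (W : EuclideanSpace ℝ (Fin d) → ℝ≥0∞) : Prop :=
  ∀ x y, ‖x‖ ≤ ‖y‖ → W y ≤ W x

namespace RadiallyDecreasing

variable {d : ℕ} {U W : EuclideanSpace ℝ (Fin d) → ℝ≥0∞}

lemma const (c : ℝ≥0∞) : RadiallyDecreasing fun _ : EuclideanSpace ℝ (Fin d) => c :=
  fun _ _ _ => le_rfl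

lemma mul (hU : RadiallyDecreasing U) (hW : RadiallyDecreasing W) :
    RadiallyDecreasing fun y => U y * W y := fun x y h => mul_le_mul' (hU x y h) (hW x y h)

lemma indicator_ballStar (A : Set (EuclideanSpace ℝ (Fin d))) :
    RadiallyDecreasing ((ballStar A).indicator fun _ => (1 : ℝ≥0∞)) := by
  intro x y h
  by_cases hy : y ∈ ballStar A
  · have hx : x ∈ ballStar A := by
      simp only [ballStar, mem_ball_zero_iff] at hy ⊢
      exact h.trans_lt hy
    simp [hx, hy]
  · simp [hy]

lemma of_symmRearrange (f : EuclideanSpace ℝ (Fin d) → ℝ) :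
    RadiallyDecreasing (symmRearrange f) := fun x y h =>
  lintegral_mono fun t => indicator_ballStar {y | t < f y} x y h

lemma apply_eq (hW : RadiallyDecreasing W) {x y : EuclideanSpace ℝ (Fin d)} (h : ‖x‖ = ‖y‖) :
    W x = W y := le_antisymm (hW y x h.ge) (hW x y h.le)

end RadiallyDecreasing

lemma ennreal_mul_add_mul_le {a b c d : ℝ≥0∞} (hba : b ≤ a) (hdc : d ≤ c) :
    a * d + b * c ≤ a * c + b * d := by
  obtain ⟨a', rfl⟩ := le_iff_exists_add.1 hba
  obtain ⟨c', rfl⟩ := le_iff_exists_add.1 hdc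
  calc (b + a') * d + b * (d + c') ≤ (b + a') * d + b * (d + c') + a' * c' := le_self_add
    _ = (b + a') * (d + c') + b * d := by ring

lemma norm_le_norm_reflection_add {F : Type*} [NormedAddCommGroup F] [InnerProductSpace ℝ F]
    {v w m : F} (hw : inner ℝ v w ≤ 0) (hm : 0 ≤ inner ℝ v m) :
    ‖w + m‖ ≤ ‖(ℝ ∙ v)ᗮ.reflection w + m‖ := by
  refine le_of_sq_le_sq ?_ (norm_nonneg _)
  rw [norm_add_sq_real, norm_add_sq_real, LinearIsometryEquiv.norm_map,
    Submodule.reflection_orthogonal_apply, Submodule.reflection_singleton_apply, neg_sub,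
    inner_sub_left, two_smul, inner_add_left, inner_smul_left]
  have : inner ℝ v w / ‖v‖ ^ 2 * inner ℝ v m ≤ 0 :=
    mul_nonpos_of_nonpos_of_nonneg (div_nonpos_of_nonpos_of_nonneg hw (by positivity)) hm
  simp only [conj_trivial, RCLike.ofReal_real_eq_id, id]
  linarith

/-- The reflection in the perpendicular bisector of `y` and `y'`. -/
noncomputable def bisectorReflection {F : Type*} [NormedAddCommGroup F] [InnerProductSpace ℝ F]
    (y y' z : F) : F :=
  (ℝ ∙ (y' - y))ᗮ.reflection (z - midpoint ℝ y y') + midpoint ℝ y y'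

section Bisector

variable {F : Type*} [NormedAddCommGroup F] [InnerProductSpace ℝ F] (y y' z : F)

lemma bisectorReflection_bisectorReflection :
    bisectorReflection y y' (bisectorReflection y y' z) = z := by
  simp [bisectorReflection]

lemma bisectorReflection_right : bisectorReflection y y' y' = y := by
  have h : y' - midpoint ℝ y y' = (2⁻¹ : ℝ) • (y' - y) := by
    rw [midpoint_eq_smul_add, invOf_eq_inv]; module
  rw [bisectorReflection, h, map_smul, Submodule.reflection_orthogonalComplement_singleton_eq_neg,
    midpoint_eq_smul_add, invOf_eq_inv]
  module

lemma norm_bisectorReflection_sub_left : ‖bisectorReflection y y' z - y‖ = ‖z - y'‖ := by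
  have h := bisectorReflection_right y y'
  calc ‖bisectorReflection y y' z - y‖ =
        ‖bisectorReflection y y' z - bisectorReflection y y' y'‖ := by rw [h]
    _ = ‖z - y'‖ := ?_
  rw [bisectorReflection, bisectorReflection, add_sub_add_right_eq_sub, ← map_sub,
    LinearIsometryEquiv.norm_map, sub_sub_sub_cancel_right]

lemma norm_bisectorReflection_sub_right : ‖bisectorReflection y y' z - y'‖ = ‖z - y‖ := by
  rw [← norm_bisectorReflection_sub_left, bisectorReflection_bisectorReflection]

variable {y y' z}

lemma norm_le_norm_bisectorReflection (hyy : ‖y‖ ≤ ‖y'‖) (hz : ‖z - y‖ ≤ ‖z - y'‖) :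
    ‖z‖ ≤ ‖bisectorReflection y y' z‖ := by
  have hm : midpoint ℝ y y' = (2⁻¹ : ℝ) • (y + y') := by
    rw [midpoint_eq_smul_add, invOf_eq_inv]
  have h := norm_le_norm_reflection_add (v := y' - y) (w := z - midpoint ℝ y y')
    (m := midpoint ℝ y y') ?_ ?_
  · rwa [sub_add_cancel] at h
  · have e1 := norm_sub_sq_real z y
    have e2 := norm_sub_sq_real z y'
    have e3 : ‖z - y‖ ^ 2 ≤ ‖z - y'‖ ^ 2 := by gcongr
    have e4 := real_inner_comm y y'
    have e5 := real_inner_comm y z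
    have e6 := real_inner_comm y' z
    rw [hm, inner_sub_right, inner_smul_right, inner_sub_left, inner_sub_left, inner_add_right,
      inner_add_right, real_inner_self_eq_norm_sq, real_inner_self_eq_norm_sq]
    linarith
  · have e3 : ‖y‖ ^ 2 ≤ ‖y'‖ ^ 2 := by gcongr
    have e4 := real_inner_comm y y'
    rw [hm, inner_smul_right, inner_sub_left, inner_add_right, inner_add_right,
      real_inner_self_eq_norm_sq, real_inner_self_eq_norm_sq]
    linarith

end Bisector

lemma measurePreserving_bisectorReflection {d : ℕ} (y y' : EuclideanSpace ℝ (Fin d)) :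
    MeasurePreserving (bisectorReflection y y') :=
  (measurePreserving_add_right volume _).comp
    ((LinearIsometryEquiv.measurePreserving _).comp (measurePreserving_sub_right volume _))

namespace RadiallyDecreasing

variable {d : ℕ} {U W : EuclideanSpace ℝ (Fin d) → ℝ≥0∞}

lemma conv (hU : RadiallyDecreasing U) (hW : RadiallyDecreasing W) (hUm : Measurable U)
    (hWm : Measurable W) : RadiallyDecreasing fun y => ∫⁻ x, U x * W (y + x) := by
  intro y y' hyy
  have hG : ∀ a, ∫⁻ x, U x * W (a + x) = ∫⁻ z, U (z - a) * W z := fun a => by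
    rw [← lintegral_sub_right_eq_self (μ := volume) (fun x => U x * W (a + x)) a]
    simp
  have hm : ∀ a, Measurable fun z => U (z - a) * W z := fun a =>
    (hUm.comp (measurable_id.sub_const a)).mul hWm
  have hs := measurePreserving_bisectorReflection y y'
  have h2 : ∀ a, 2 * ∫⁻ z, U (z - a) * W z = ∫⁻ z, (U (z - a) * W z +
      U (bisectorReflection y y' z - a) * W (bisectorReflection y y' z)) := fun a => by
    rw [lintegral_add_left (hm a), hs.lintegral_comp (hm a), two_mul]
  simp only [hG]
  rw [← ENNReal.mul_le_mul_iff_right two_ne_zero ENNReal.ofNat_ne_top, h2, h2]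
  refine lintegral_mono fun z => ?_
  rw [hU.apply_eq (norm_bisectorReflection_sub_left y y' z),
    hU.apply_eq (norm_bisectorReflection_sub_right y y' z)]
  rcases le_total ‖z - y‖ ‖z - y'‖ with h | h
  · rw [add_comm]
    exact ennreal_mul_add_mul_le (hU _ _ h) (hW _ _ (norm_le_norm_bisectorReflection hyy h))
  · have h' := norm_le_norm_bisectorReflection (z := bisectorReflection y y' z) hyy (by
      rwa [norm_bisectorReflection_sub_left, norm_bisectorReflection_sub_right])
    rw [bisectorReflection_bisectorReflection] at h'
    rw [add_comm (U (z - y) * W z)]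
    exact ennreal_mul_add_mul_le (hU _ _ h) (hW _ _ h')

end RadiallyDecreasing

lemma exists_volume_eq_of_subset {n : ℕ} {P Q : Set (EuclideanSpace ℝ (Fin (n + 1)))}
    (hP : MeasurableSet P) (hQ : MeasurableSet Q) (hPQ : P ⊆ Q) (hQtop : volume Q ≠ ⊤)
    {c : ℝ≥0∞} (hPc : volume P ≤ c) (hcQ : c ≤ volume Q) :
    ∃ C, MeasurableSet C ∧ P ⊆ C ∧ C ⊆ Q ∧ volume C = c := by
  rcases hPc.eq_or_lt with h | hPc
  · exact ⟨P, hP, subset_rfl, hPQ, h⟩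
  rcases hcQ.eq_or_lt with h | hcQ
  · exact ⟨Q, hQ, hPQ, subset_rfl, h.symm⟩
  have hPtop : volume P ≠ ⊤ := measure_ne_top_of_subset hPQ hQtop
  obtain ⟨ν, hν⟩ : ∃ ν, ν = (volume.restrict (Q \ P)).map
    (norm : EuclideanSpace ℝ (Fin (n + 1)) → ℝ) := ⟨_, rfl⟩
  have hνapp : ∀ S, MeasurableSet S → ν S = volume (norm ⁻¹' S ∩ (Q \ P)) := fun S hS => by
    rw [hν, Measure.map_apply measurable_norm hS, Measure.restrict_apply (measurable_norm hS)]
  have hνuniv : ν Set.univ = volume Q - volume P := by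
    rw [hνapp _ MeasurableSet.univ, Set.preimage_univ, Set.univ_inter,
      measure_sdiff hPQ hP.nullMeasurableSet hPtop]
  have : IsFiniteMeasure ν := ⟨by
    rw [hνuniv]; exact (tsub_le_self.trans_lt hQtop.lt_top)⟩
  have : NullSingletonClass ν := ⟨fun r => by
    rw [hνapp _ (measurableSet_singleton r)]
    refine measure_mono_null Set.inter_subset_left ?_
    have : norm ⁻¹' {r} = Metric.sphere (0 : EuclideanSpace ℝ (Fin (n + 1))) r := by ext; simp
    rw [this]
    exact Measure.addHaar_sphere _ _ _⟩
  obtain ⟨β, hβ⟩ := exists_measure_Iic_eq ν (t := c - volume P) (tsub_pos_of_lt hPc) (by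
    rw [hνuniv]
    exact ENNReal.sub_lt_of_lt_add hPc.le (by rwa [tsub_add_cancel_of_le (hPc.le.trans hcQ.le)]))
  rw [hνapp _ measurableSet_Iic] at hβ
  refine ⟨P ∪ (norm ⁻¹' Set.Iic β ∩ (Q \ P)),
    hP.union ((measurable_norm measurableSet_Iic).inter (hQ.diff hP)), Set.subset_union_left,
    Set.union_subset hPQ (Set.inter_subset_right.trans Set.sdiff_subset), ?_⟩
  rw [measure_union _ ((measurable_norm measurableSet_Iic).inter (hQ.diff hP)), hβ,
    add_tsub_cancel_of_le hPc.le]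
  exact Set.disjoint_left.2 fun x hx h => h.2.2 hx

/-- **Bathtub principle**: among sets of volume at most `c`, a suitable one captures the part of
`h` obtained by truncating its distribution function at `c`. -/
lemma exists_setLIntegral_ge_min {n : ℕ} {h : EuclideanSpace ℝ (Fin (n + 1)) → ℝ≥0∞}
    (hm : Measurable h) {M : ℝ} (hM : ∀ x, h x ≤ ENNReal.ofReal M)
    (hfin : ∀ s : ℝ, 0 < s → volume {x | ENNReal.ofReal s < h x} ≠ ⊤) (c : ℝ≥0∞) :
    ∃ C, MeasurableSet C ∧ volume C ≤ c ∧
      ∫⁻ s in Set.Ioi (0 : ℝ), min (volume {x | ENNReal.ofReal s < h x}) c ≤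
        ∫⁻ x in C, h x := by
  obtain ⟨L, hL⟩ : ∃ L : ℝ → Set (EuclideanSpace ℝ (Fin (n + 1))),
    ∀ s x, x ∈ L s ↔ ENNReal.ofReal s < h x := ⟨fun s => {x | ENNReal.ofReal s < h x}, fun _ _ =>
      Iff.rfl⟩
  have hLeq : ∀ s, {x | ENNReal.ofReal s < h x} = L s := fun s => by ext x; exact (hL s x).symm
  simp only [hLeq] at hfin ⊢
  have hLm : ∀ s, MeasurableSet (L s) := fun s => by
    rw [← hLeq]; exact measurableSet_lt measurable_const hm
  have hLanti : Antitone L := fun s t hst x hx => by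
    rw [hL] at hx ⊢
    exact (ENNReal.ofReal_le_ofReal hst).trans_lt hx
  obtain ⟨S, hS⟩ : ∃ S, S = {s : ℝ | 0 ≤ s ∧ volume (L s) ≤ c} := ⟨_, rfl⟩
  have hSne : S.Nonempty := by
    refine ⟨max M 0, hS ▸ ⟨le_max_right _ _, ?_⟩⟩
    have : L (max M 0) = ∅ := Set.eq_empty_iff_forall_notMem.2 fun x hx =>
      ((hL _ _).1 hx).not_ge ((hM x).trans (ENNReal.ofReal_le_ofReal (le_max_left _ _)))
    simp [this]
  have hSbdd : BddBelow S := ⟨0, fun s hs => by rw [hS] at hs; exact hs.1⟩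
  obtain ⟨s₀, hs₀⟩ : ∃ s₀, s₀ = sInf S := ⟨_, rfl⟩
  have hs₀nn : 0 ≤ s₀ := hs₀ ▸ le_csInf hSne fun s hs => by rw [hS] at hs; exact hs.1
  have hlow : ∀ s, 0 ≤ s → s < s₀ → c < volume (L s) := fun s h0 hs => by
    by_contra! hc
    exact hs.not_ge (hs₀ ▸ csInf_le hSbdd (hS ▸ ⟨h0, hc⟩))
  have hhigh : ∀ s, s₀ < s → volume (L s) ≤ c := fun s hs => by
    obtain ⟨r, hr, hrs⟩ := exists_lt_of_csInf_lt hSne (hs₀ ▸ hs)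
    rw [hS] at hr
    exact (measure_mono (hLanti hrs.le)).trans hr.2
  have hs₀c : volume (L s₀) ≤ c := by
    obtain ⟨u, hu, hus, hut⟩ := exists_seq_strictAnti_tendsto s₀
    have hU : L s₀ = ⋃ k, L (u k) := by
      ext x
      simp only [Set.mem_iUnion, hL]
      refine ⟨fun hx => ?_, fun ⟨k, hk⟩ => (ENNReal.ofReal_le_ofReal (hus k).le).trans_lt hk⟩
      exact (((ENNReal.continuous_ofReal.tendsto _).comp hut).eventually_lt_const hx).exists
    rw [hU, Monotone.measure_iUnion (fun i j hij => hLanti (hu.antitone hij))]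
    exact iSup_le fun k => hhigh _ (hus k)
  obtain ⟨C, hCm, hCc, hsub, hlowC⟩ : ∃ C, MeasurableSet C ∧ volume C ≤ c ∧ L s₀ ⊆ C ∧
      ∀ s, 0 < s → s < s₀ → c ≤ volume (L s ∩ C) := by
    rcases hs₀nn.eq_or_lt with h0 | h0
    · exact ⟨L s₀, hLm _, hs₀c, subset_rfl, fun s h1 h2 => by linarith⟩
    obtain ⟨u, hu, hus, hut⟩ := exists_seq_strictMono_tendsto' h0
    have hQ : {x | ENNReal.ofReal s₀ ≤ h x} = ⋂ k, L (u k) := by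
      ext x
      simp only [Set.mem_iInter, hL, Set.mem_ofPred_eq]
      refine ⟨fun hx k => ((ENNReal.ofReal_lt_ofReal_iff h0).2 (hus k).2).trans_le hx,
        fun hx => ?_⟩
      exact le_of_tendsto' ((ENNReal.continuous_ofReal.tendsto _).comp hut) fun k => (hx k).le
    have hQsub : ∀ s, s < s₀ → {x | ENNReal.ofReal s₀ ≤ h x} ⊆ L s := fun s hs x hx =>
      (hL _ _).2 (((ENNReal.ofReal_lt_ofReal_iff h0).2 hs).trans_le hx)
    have hQc : c ≤ volume {x | ENNReal.ofReal s₀ ≤ h x} := by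
      rw [hQ, Antitone.measure_iInter (fun i j hij => hLanti (hu.monotone hij))
        (fun k => (hLm _).nullMeasurableSet) ⟨0, hfin _ (hus 0).1⟩]
      exact le_iInf fun k => (hlow _ (hus k).1.le (hus k).2).le
    obtain ⟨C, h1, h2, h3, h4⟩ := exists_volume_eq_of_subset (hLm s₀)
      (measurableSet_le measurable_const hm) (fun x hx => ((hL _ _).1 hx).le)
      (measure_ne_top_of_subset (hQsub _ (hus 0).2) (hfin _ (hus 0).1)) hs₀c hQc
    refine ⟨C, h1, h4.le, h2, fun s hs hs' => ?_⟩
    rw [Set.inter_eq_right.2 (h3.trans (hQsub s hs')), h4]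
  refine ⟨C, hCm, hCc, ?_⟩
  rw [lintegral_eq_lintegral_superlevel hm]
  refine setLIntegral_mono' measurableSet_Ioi fun s hs => ?_
  rw [hLeq, Measure.restrict_apply (hLm s)]
  rcases lt_or_ge s s₀ with h | h
  · exact (min_le_right _ _).trans (hlowC s hs h)
  · rw [Set.inter_eq_left.2 ((hLanti h).trans hsub)]
    exact min_le_left _ _

section ConvStep

variable {n : ℕ} {V W : EuclideanSpace ℝ (Fin (n + 1)) → ℝ≥0∞}

lemma RadiallyDecreasing.superlevel_subset_ball (hW : RadiallyDecreasing W) {τ : ℝ≥0∞}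
    {x : EuclideanSpace ℝ (Fin (n + 1))} (hx : ¬ τ < W x) :
    {x | τ < W x} ⊆ Metric.ball 0 ‖x‖ := fun y hy => by
  rw [mem_ball_zero_iff]
  by_contra! h
  exact hx (lt_of_lt_of_le hy (hW x y h))

lemma RadiallyDecreasing.ballStar_subset_superlevel (hW : RadiallyDecreasing W) {τ : ℝ≥0∞}
    {C : Set (EuclideanSpace ℝ (Fin (n + 1)))} (hC : volume C ≤ volume {x | τ < W x}) :
    ballStar C ⊆ {x | τ < W x} := by
  intro x hx
  by_contra hxT
  have h2 := ballStar_mono measure_ball_lt_top.ne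
    (hC.trans (measure_mono (hW.superlevel_subset_ball hxT))) hx
  rw [ballStar, symmRadius_ball (norm_nonneg x), mem_ball_zero_iff] at h2
  exact lt_irrefl _ h2

/-- The density of the sums of pairs of points in `C × B`. -/
noncomputable def sumDensity (C B : Set (EuclideanSpace ℝ (Fin (n + 1))))
    (z : EuclideanSpace ℝ (Fin (n + 1))) : ℝ≥0∞ :=
  ∫⁻ y in C, B.indicator (fun _ => 1) (z - y)

lemma measurable_sumDensity {C B : Set (EuclideanSpace ℝ (Fin (n + 1)))} (hB : MeasurableSet B) :
    Measurable (sumDensity C B) := by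
  have h : Measurable fun p : EuclideanSpace ℝ (Fin (n + 1)) × EuclideanSpace ℝ (Fin (n + 1)) =>
      B.indicator (fun _ => (1 : ℝ≥0∞)) (p.1 - p.2) :=
    (measurable_const.indicator hB).comp (measurable_fst.sub measurable_snd)
  exact h.lintegral_prod_right'

lemma lintegral_lintegral_add_eq {C B : Set (EuclideanSpace ℝ (Fin (n + 1)))}
    (hB : MeasurableSet B) (hV : Measurable V) :
    ∫⁻ y in C, ∫⁻ x in B, V (y + x) = ∫⁻ z, sumDensity C B z * V z := by
  have hi : Measurable (B.indicator fun _ => (1 : ℝ≥0∞)) := measurable_const.indicator hB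
  have h1 : ∀ y, ∫⁻ x in B, V (y + x) = ∫⁻ z, B.indicator (fun _ => 1) (z - y) * V z := by
    intro y
    rw [← lintegral_indicator hB, ← lintegral_sub_right_eq_self _ y]
    refine lintegral_congr fun z => ?_
    by_cases h : z - y ∈ B <;> simp [h]
  simp_rw [h1]
  rw [lintegral_lintegral_swap (f := fun y z => B.indicator (fun _ => 1) (z - y) * V z)]
  · refine lintegral_congr fun z => ?_
    exact lintegral_mul_const _ (hi.comp (measurable_const.sub measurable_id))
  · exact ((hi.comp (measurable_snd.sub measurable_fst)).mul
      (hV.comp measurable_snd)).aemeasurable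

lemma sumTriple_eq_lintegral {C B T : Set (EuclideanSpace ℝ (Fin (n + 1)))}
    (hC : MeasurableSet C) (hB : MeasurableSet B) (hT : MeasurableSet T) :
    sumTriple C B T = ∫⁻ y in C, ∫⁻ x in B, T.indicator (fun _ => 1) (y + x) := by
  have hm : Measurable fun p : EuclideanSpace ℝ (Fin (n + 1)) × EuclideanSpace ℝ (Fin (n + 1)) =>
      T.indicator (fun _ => (1 : ℝ≥0∞)) (p.1 + p.2) :=
    (measurable_const.indicator hT).comp (measurable_fst.add measurable_snd)
  rw [lintegral_lintegral (f := fun y x => T.indicator (fun _ => (1 : ℝ≥0∞)) (y + x))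
    hm.aemeasurable, Measure.prod_restrict, ← lintegral_indicator (hC.prod hB), sumTriple,
    ← lintegral_indicator_one (measurableSet_sumTriple hC hB hT), Measure.volume_eq_prod]
  refine lintegral_congr fun p => ?_
  by_cases h1 : p.1 ∈ C <;> by_cases h2 : p.2 ∈ B <;> by_cases h3 : p.1 + p.2 ∈ T <;>
    simp [Set.indicator, h1, h2, h3]

lemma sumTriple_eq_setLIntegral_sumDensity {C B T : Set (EuclideanSpace ℝ (Fin (n + 1)))}
    (hC : MeasurableSet C) (hB : MeasurableSet B) (hT : MeasurableSet T) :
    sumTriple C B T = ∫⁻ z in T, sumDensity C B z := by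
  rw [sumTriple_eq_lintegral hC hB hT,
    lintegral_lintegral_add_eq hB (measurable_const.indicator hT),
    ← lintegral_indicator hT]
  refine lintegral_congr fun z => ?_
  by_cases h : z ∈ T <;> simp [h]

lemma sumTriple_univ {C B : Set (EuclideanSpace ℝ (Fin (n + 1)))} :
    sumTriple C B Set.univ = volume C * volume B := by
  rw [sumTriple, ← Measure.prod_prod]
  congr 1
  ext p
  simp

lemma sumDensity_le (C B : Set (EuclideanSpace ℝ (Fin (n + 1))))
    (z : EuclideanSpace ℝ (Fin (n + 1))) : sumDensity C B z ≤ volume C := by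
  rw [sumDensity, ← setLIntegral_one]
  refine lintegral_mono fun y => ?_
  exact Set.indicator_le_self' (fun _ _ => zero_le) _

lemma lintegral_sumDensity {C B : Set (EuclideanSpace ℝ (Fin (n + 1)))} (hC : MeasurableSet C)
    (hB : MeasurableSet B) : ∫⁻ z, sumDensity C B z = volume C * volume B := by
  rw [← setLIntegral_univ, ← sumTriple_eq_setLIntegral_sumDensity hC hB MeasurableSet.univ,
    sumTriple_univ]

lemma volume_sumDensity_superlevel {C B : Set (EuclideanSpace ℝ (Fin (n + 1)))}
    (hC : MeasurableSet C) (hB : MeasurableSet B) (hCf : volume C ≠ ⊤) (hBf : volume B ≠ ⊤)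
    {s : ℝ} (hs : 0 < s) : volume {z | ENNReal.ofReal s < sumDensity C B z} ≠ ⊤ := by
  have hsub : {z | ENNReal.ofReal s < sumDensity C B z} ⊆
      {z | ENNReal.ofReal s ≤ sumDensity C B z} := fun z (hz : ENNReal.ofReal s < _) => hz.le
  refine ne_top_of_le_ne_top ?_ ((measure_mono hsub).trans
    (meas_ge_le_lintegral_div (measurable_sumDensity hB).aemeasurable
      (ENNReal.ofReal_pos.2 hs).ne' ENNReal.ofReal_ne_top))
  rw [lintegral_sumDensity hC hB]
  exact ENNReal.div_ne_top (ENNReal.mul_ne_top hCf hBf) (ENNReal.ofReal_pos.2 hs).ne'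

lemma lintegral_volume_inter_le {C B T : Set (EuclideanSpace ℝ (Fin (n + 1)))}
    (hC : MeasurableSet C) (hB : MeasurableSet B) (hCf : volume C ≠ ⊤)
    (hBf : volume B ≠ ⊤) (hT : ∀ C' : Set (EuclideanSpace ℝ (Fin (n + 1))),
      volume C' ≤ volume T → ballStar C' ⊆ T) (hTinf : volume T = ⊤ → T = Set.univ) :
    ∫⁻ s in Set.Ioi (0 : ℝ), volume (T ∩ ballStar {z | ENNReal.ofReal s < sumDensity C B z}) ≤
      sumTriple (ballStar C) (ballStar B) T := by
  have hm := measurable_sumDensity (C := C) hB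
  have hfin : ∀ s : ℝ, 0 < s → volume {z | ENNReal.ofReal s < sumDensity C B z} ≠ ⊤ :=
    fun s hs => volume_sumDensity_superlevel hC hB hCf hBf hs
  have hle : ∀ s ∈ Set.Ioi (0 : ℝ),
      volume (T ∩ ballStar {z | ENNReal.ofReal s < sumDensity C B z}) ≤
        min (volume {z | ENNReal.ofReal s < sumDensity C B z}) (volume T) := fun s hs =>
    le_min ((measure_mono Set.inter_subset_right).trans_eq (volume_ballStar (hfin s hs)))
      (measure_mono Set.inter_subset_left)
  refine (setLIntegral_mono' measurableSet_Ioi hle).trans ?_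
  by_cases hTtop : volume T = ⊤
  · simp only [hTtop, le_top, min_eq_left]
    rw [hTinf hTtop, sumTriple_univ, volume_ballStar hCf, volume_ballStar hBf,
      ← lintegral_sumDensity hC hB,
      lintegral_eq_lintegral_superlevel hm]
  · obtain ⟨C', hC', hC'T, hC'le⟩ := exists_setLIntegral_ge_min hm (M := (volume C).toReal)
      (fun z => by
        rw [ENNReal.ofReal_toReal hCf]
        exact sumDensity_le C B z) hfin (volume T)
    refine hC'le.trans ?_
    rw [← sumTriple_eq_setLIntegral_sumDensity hC hB hC']
    exact (sumTriple_le_ballStar hC hB hC' hCf hBf (ne_top_of_le_ne_top hTtop hC'T)).trans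
      (sumTriple_mono subset_rfl subset_rfl (hT C' hC'T))

lemma LessConcentrated.lintegral_lintegral_add_le (h : LessConcentrated V W)
    (hV : Measurable V) (hW : Measurable W) (hWr : RadiallyDecreasing W)
    {C B : Set (EuclideanSpace ℝ (Fin (n + 1)))} (hC : MeasurableSet C) (hB : MeasurableSet B)
    (hCf : volume C ≠ ⊤) (hBf : volume B ≠ ⊤) :
    ∫⁻ y in C, ∫⁻ x in B, V (y + x) ≤ ∫⁻ y in ballStar C, ∫⁻ x in ballStar B, W (y + x) := by
  have hm := measurable_sumDensity (C := C) hB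
  obtain ⟨g, hg⟩ : ∃ g, g = fun z => (sumDensity C B z).toReal := ⟨_, rfl⟩
  have hgs : ∀ s ∈ Set.Ioi (0 : ℝ),
      {z | ENNReal.ofReal s < sumDensity C B z} = {z | s < g z} := fun s hs => by
    ext z
    rw [hg]
    exact ENNReal.ofReal_lt_iff_lt_toReal (le_of_lt hs)
      (ne_top_of_le_ne_top hCf (sumDensity_le C B z))
  calc ∫⁻ y in C, ∫⁻ x in B, V (y + x)
      = ∫⁻ s in Set.Ioi (0 : ℝ), ∫⁻ z in {z | ENNReal.ofReal s < sumDensity C B z}, V z := by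
        rw [lintegral_lintegral_add_eq hB hV, lintegral_mul_eq_lintegral_superlevel hm hV]
    _ ≤ ∫⁻ s in Set.Ioi (0 : ℝ), ∫⁻ z in ballStar {z | s < g z}, W z := by
        refine setLIntegral_mono' measurableSet_Ioi fun s hs => ?_
        rw [← hgs s hs]
        exact h _ (measurableSet_lt measurable_const hm)
          (volume_sumDensity_superlevel hC hB hCf hBf hs)
    _ = ∫⁻ z, W z * symmRearrange g z := by
        rw [← lintegral_symmRearrange_mul_eq g hW]
        simp only [mul_comm]
    _ = ∫⁻ τ in Set.Ioi (0 : ℝ), ∫⁻ s in Set.Ioi (0 : ℝ),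
          volume ({x | ENNReal.ofReal τ < W x} ∩
            ballStar {z | ENNReal.ofReal s < sumDensity C B z}) := by
        rw [lintegral_mul_eq_lintegral_superlevel hW (measurable_symmRearrange g)]
        refine lintegral_congr fun τ => ?_
        have := lintegral_symmRearrange_mul_eq (μ := volume.restrict {x | ENNReal.ofReal τ < W x}) g
          (W := fun _ => 1) measurable_const
        simp only [mul_one] at this
        rw [this]
        refine setLIntegral_congr_fun measurableSet_Ioi fun s hs => ?_
        rw [hgs s hs, setLIntegral_one, Measure.restrict_apply (measurableSet_ballStar _),
          Set.inter_comm]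
    _ ≤ ∫⁻ τ in Set.Ioi (0 : ℝ),
          sumTriple (ballStar C) (ballStar B) {x | ENNReal.ofReal τ < W x} := by
        refine lintegral_mono fun τ => lintegral_volume_inter_le hC hB hCf hBf
          (fun C' hC' => hWr.ballStar_subset_superlevel hC') fun htop => ?_
        by_contra hne
        obtain ⟨x, hx⟩ := (Set.ne_univ_iff_exists_notMem _).1 hne
        exact measure_ne_top_of_subset (hWr.superlevel_subset_ball hx) measure_ball_lt_top.ne htop
    _ = ∫⁻ y in ballStar C, ∫⁻ x in ballStar B, W (y + x) := by
        rw [lintegral_lintegral_add_eq (measurableSet_ballStar B) hW]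
        simp only [mul_comm]
        rw [lintegral_mul_eq_lintegral_superlevel hW
          (measurable_sumDensity (measurableSet_ballStar B))]
        refine lintegral_congr fun τ => ?_
        exact sumTriple_eq_setLIntegral_sumDensity (measurableSet_ballStar C)
          (measurableSet_ballStar B) (measurableSet_lt measurable_const hW)

end ConvStep

section Multiplier

variable {n : ℕ}

lemma LessConcentrated.one :
    LessConcentrated (fun _ : EuclideanSpace ℝ (Fin (n + 1)) => 1) fun _ => 1 := fun C _ hCf => by
  rw [setLIntegral_one, setLIntegral_one, volume_ballStar hCf]

/-- Multiplication by `G` and `G'` respectively preserves the relation `LessConcentrated`. -/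
structure IsRearrangedMultiplier (G G' : EuclideanSpace ℝ (Fin (n + 1)) → ℝ≥0∞) : Prop where
  measurable_left : Measurable G
  measurable_right : Measurable G'
  radiallyDecreasing : RadiallyDecreasing G'
  lessConcentrated_mul : ∀ {V W : EuclideanSpace ℝ (Fin (n + 1)) → ℝ≥0∞}, Measurable V →
    Measurable W → LessConcentrated V W →
      LessConcentrated (fun y => G y * V y) fun y => G' y * W y

namespace IsRearrangedMultiplier

lemma one : IsRearrangedMultiplier (fun _ : EuclideanSpace ℝ (Fin (n + 1)) => 1) fun _ => 1 :=
  ⟨measurable_const, measurable_const, .const 1, fun _ _ h => by simpa using h⟩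

lemma mul {G G' H H' : EuclideanSpace ℝ (Fin (n + 1)) → ℝ≥0∞} (hG : IsRearrangedMultiplier G G')
    (hH : IsRearrangedMultiplier H H') :
    IsRearrangedMultiplier (fun y => G y * H y) fun y => G' y * H' y where
  measurable_left := hG.measurable_left.mul hH.measurable_left
  measurable_right := hG.measurable_right.mul hH.measurable_right
  radiallyDecreasing := hG.radiallyDecreasing.mul hH.radiallyDecreasing
  lessConcentrated_mul hV hW h := by
    simp only [mul_assoc]
    exact hG.lessConcentrated_mul (hH.measurable_left.mul hV) (hH.measurable_right.mul hW)
      (hH.lessConcentrated_mul hV hW h)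

lemma prod {ι : Type*} (s : Finset ι) {G G' : ι → EuclideanSpace ℝ (Fin (n + 1)) → ℝ≥0∞}
    (h : ∀ i, IsRearrangedMultiplier (G i) (G' i)) :
    IsRearrangedMultiplier (fun y => ∏ i ∈ s, G i y) fun y => ∏ i ∈ s, G' i y := by
  classical
  induction s using Finset.induction_on with
  | empty => simpa using one
  | insert a s ha ih =>
    simp only [Finset.prod_insert ha]
    exact (h a).mul ih

lemma ofReal {f : EuclideanSpace ℝ (Fin (n + 1)) → ℝ} (hf : Measurable f)
    (hfv : VanishesAtInfinity f) :
    IsRearrangedMultiplier (fun y => ENNReal.ofReal (f y)) (symmRearrange f) where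
  measurable_left := hf.ennreal_ofReal
  measurable_right := measurable_symmRearrange f
  radiallyDecreasing := .of_symmRearrange f
  lessConcentrated_mul {V W} hV hW h C hC hCf := by
    rw [lintegral_ofReal_mul_eq hf hV, lintegral_symmRearrange_mul_eq f hW]
    refine setLIntegral_mono' measurableSet_Ioi fun t ht => ?_
    have hm : MeasurableSet {x | t < f x} := measurableSet_lt measurable_const hf
    rw [Measure.restrict_restrict hm, Measure.restrict_restrict (measurableSet_ballStar _)]
    refine (h _ (hm.inter hC) (measure_ne_top_of_subset Set.inter_subset_right hCf)).trans ?_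
    exact lintegral_mono_set (Set.subset_inter
      (ballStar_mono (hfv t ht).ne (measure_mono Set.inter_subset_left))
      (ballStar_mono hCf (measure_mono Set.inter_subset_right)))

lemma indicator {D : Set (EuclideanSpace ℝ (Fin (n + 1)))} (hD : MeasurableSet D)
    (hDf : volume D ≠ ⊤) :
    IsRearrangedMultiplier (D.indicator fun _ => 1) ((ballStar D).indicator fun _ => 1) where
  measurable_left := measurable_const.indicator hD
  measurable_right := measurable_const.indicator (measurableSet_ballStar D)
  radiallyDecreasing := .indicator_ballStar D
  lessConcentrated_mul {V W} hV hW h C hC hCf := by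
    have key : ∀ (T : Set (EuclideanSpace ℝ (Fin (n + 1))))
        (U : EuclideanSpace ℝ (Fin (n + 1)) → ℝ≥0∞),
        (fun y => T.indicator (fun _ => 1) y * U y) = T.indicator U := fun T U => by
      ext y
      by_cases hy : y ∈ T <;> simp [hy]
    rw [key, key, lintegral_indicator hD, lintegral_indicator (measurableSet_ballStar D),
      Measure.restrict_restrict hD, Measure.restrict_restrict (measurableSet_ballStar _)]
    refine (h _ (hD.inter hC) (measure_ne_top_of_subset Set.inter_subset_right hCf)).trans ?_
    exact lintegral_mono_set (Set.subset_inter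
      (ballStar_mono hDf (measure_mono Set.inter_subset_left))
      (ballStar_mono hCf (measure_mono Set.inter_subset_right)))

end IsRearrangedMultiplier

end Multiplier

section Convolution

variable {n : ℕ} {V W : EuclideanSpace ℝ (Fin (n + 1)) → ℝ≥0∞}
  {φ : EuclideanSpace ℝ (Fin (n + 1)) → ℝ}

lemma measurable_lintegral_mul_add {d : ℕ} {U V : EuclideanSpace ℝ (Fin d) → ℝ≥0∞}
    (hU : Measurable U) (hV : Measurable V) : Measurable fun y => ∫⁻ x, U x * V (y + x) := by
  have h : Measurable fun p : EuclideanSpace ℝ (Fin d) × EuclideanSpace ℝ (Fin d) =>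
      U p.2 * V (p.1 + p.2) :=
    (hU.comp measurable_snd).mul (hV.comp (measurable_fst.add measurable_snd))
  exact h.lintegral_prod_right'

lemma setLIntegral_lintegral_mul_add_swap {d : ℕ} {U V : EuclideanSpace ℝ (Fin d) → ℝ≥0∞}
    (hU : Measurable U) (hV : Measurable V) (C : Set (EuclideanSpace ℝ (Fin d))) :
    ∫⁻ y in C, ∫⁻ x, U x * V (y + x) = ∫⁻ x, U x * ∫⁻ y in C, V (y + x) := by
  have h : Measurable fun p : EuclideanSpace ℝ (Fin d) × EuclideanSpace ℝ (Fin d) =>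
      U p.2 * V (p.1 + p.2) :=
    (hU.comp measurable_snd).mul (hV.comp (measurable_fst.add measurable_snd))
  rw [lintegral_lintegral_swap (f := fun y x => U x * V (y + x)) h.aemeasurable]
  refine lintegral_congr fun x => ?_
  exact lintegral_const_mul _ (hV.comp (measurable_id.add_const x))

lemma measurable_setLIntegral_add {d : ℕ} {V : EuclideanSpace ℝ (Fin d) → ℝ≥0∞}
    (hV : Measurable V) (C : Set (EuclideanSpace ℝ (Fin d))) :
    Measurable fun x => ∫⁻ y in C, V (y + x) :=
  (hV.comp (measurable_fst.add measurable_snd) : Measurable fun p :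
    EuclideanSpace ℝ (Fin d) × EuclideanSpace ℝ (Fin d) => V (p.1 + p.2)).lintegral_prod_left'

lemma LessConcentrated.conv (h : LessConcentrated V W) (hV : Measurable V) (hW : Measurable W)
    (hWr : RadiallyDecreasing W) (hφ : Measurable φ) (hφv : VanishesAtInfinity φ) :
    LessConcentrated (fun y => ∫⁻ x, ENNReal.ofReal (φ x) * V (y + x))
      fun y => ∫⁻ x, symmRearrange φ x * W (y + x) := by
  intro C hC hCf
  rw [setLIntegral_lintegral_mul_add_swap hφ.ennreal_ofReal hV,
    setLIntegral_lintegral_mul_add_swap (measurable_symmRearrange φ) hW,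
    lintegral_ofReal_mul_eq hφ (measurable_setLIntegral_add hV C),
    lintegral_symmRearrange_mul_eq φ (measurable_setLIntegral_add hW _)]
  refine setLIntegral_mono' measurableSet_Ioi fun t ht => ?_
  have hsw : ∀ {U : EuclideanSpace ℝ (Fin (n + 1)) → ℝ≥0∞}, Measurable U →
      ∀ A B : Set (EuclideanSpace ℝ (Fin (n + 1))),
        ∫⁻ x in A, ∫⁻ y in B, U (y + x) = ∫⁻ y in B, ∫⁻ x in A, U (y + x) := fun hU A B =>
    lintegral_lintegral_swap (hU.comp (measurable_snd.add measurable_fst)).aemeasurable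
  rw [hsw hV, hsw hW]
  exact h.lintegral_lintegral_add_le hV hW hWr hC (measurableSet_lt measurable_const hφ) hCf
    (hφv t ht).ne

lemma LessConcentrated.lintegral_mul_add_le (h : LessConcentrated V W) (hV : Measurable V)
    (hW : Measurable W) (hφ : Measurable φ) (hφv : VanishesAtInfinity φ)
    (a : EuclideanSpace ℝ (Fin (n + 1))) :
    ∫⁻ x, ENNReal.ofReal (φ x) * V (a + x) ≤ ∫⁻ x, symmRearrange φ x * W (0 + x) := by
  have hVa : Measurable fun x => V (a + x) := hV.comp (measurable_const_add a)
  simp only [zero_add]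
  rw [lintegral_ofReal_mul_eq hφ hVa,
    lintegral_symmRearrange_mul_eq φ hW]
  refine setLIntegral_mono' measurableSet_Ioi fun t ht => ?_
  have hm : MeasurableSet {x | t < φ x} := measurableSet_lt measurable_const hφ
  have hp := measurePreserving_add_left volume (-a)
  have hvol : volume ((-a + ·) ⁻¹' {x | t < φ x}) = volume {x | t < φ x} :=
    hp.measure_preimage hm.nullMeasurableSet
  rw [← ballStar_congr hvol]
  refine le_trans (le_of_eq ?_) (h _ (hp.measurable hm) (hvol ▸ (hφv t ht).ne))
  rw [← lintegral_indicator hm, ← lintegral_indicator (hp.measurable hm),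
    ← lintegral_add_left_eq_self _ (-a)]
  refine lintegral_congr fun x => ?_
  by_cases hx : t < φ (-a + x) <;> simp [Set.indicator, hx]

end Convolution

section Chain

variable {E : Type*} [MeasureSpace E] [AddCommGroup E]

/-- The expected product of `G j` along the walk with step density `u` started at a given point,
where `j` runs over the times `0, …, K`. -/
noncomputable def walkIntegral (u : E → ℝ≥0∞) : ℕ → (ℕ → E → ℝ≥0∞) → E → ℝ≥0∞
  | 0, G => G 0
  | K + 1, G => fun y => G 0 y * ∫⁻ x, u x * walkIntegral u K (fun j => G (j + 1)) (y + x)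

end Chain

lemma measurable_walkIntegral {d : ℕ} {u : EuclideanSpace ℝ (Fin d) → ℝ≥0∞} (hu : Measurable u)
    (K : ℕ) {G : ℕ → EuclideanSpace ℝ (Fin d) → ℝ≥0∞} (hG : ∀ j, Measurable (G j)) :
    Measurable (walkIntegral u K G) := by
  induction K generalizing G with
  | zero => exact hG 0
  | succ K ih => exact (hG 0).mul (measurable_lintegral_mul_add hu (ih fun j => hG (j + 1)))

lemma partialSum_zero {d K : ℕ} (x : Fin K → EuclideanSpace ℝ (Fin d)) : partialSum x 0 = 0 := by
  simp [partialSum]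

lemma partialSum_cons {d K : ℕ} (a : EuclideanSpace ℝ (Fin d))
    (x : Fin K → EuclideanSpace ℝ (Fin d)) (j : ℕ) :
    partialSum (Fin.cons a x : Fin (K + 1) → EuclideanSpace ℝ (Fin d)) (j + 1) =
      a + partialSum x j := by
  simp [partialSum, Fin.sum_univ_succ]

lemma measurable_partialSum {d K : ℕ} (j : ℕ) :
    Measurable fun x : Fin K → EuclideanSpace ℝ (Fin d) => partialSum x j := by
  unfold partialSum
  refine Finset.measurable_sum _ fun i _ => ?_
  split_ifs
  · exact measurable_pi_apply i
  · exact measurable_const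

lemma lintegral_walk_eq {d : ℕ} {u : EuclideanSpace ℝ (Fin d) → ℝ≥0∞} (hu : Measurable u)
    (K : ℕ) {G : ℕ → EuclideanSpace ℝ (Fin d) → ℝ≥0∞} (hG : ∀ j, Measurable (G j))
    (y : EuclideanSpace ℝ (Fin d)) :
    ∫⁻ x : Fin K → EuclideanSpace ℝ (Fin d),
      (∏ j ∈ Finset.range (K + 1), G j (y + partialSum x j)) * ∏ j, u (x j) =
        walkIntegral u K G y := by
  induction K generalizing G y with
  | zero => simp [partialSum_zero, walkIntegral, volume_pi]
  | succ K ih =>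
    have hmK : ∀ y : EuclideanSpace ℝ (Fin d),
        Measurable fun x : Fin K → EuclideanSpace ℝ (Fin d) =>
        (∏ j ∈ Finset.range (K + 1), G (j + 1) (y + partialSum x j)) * ∏ j, u (x j) := fun y =>
      (Finset.measurable_prod _ fun j _ =>
        (hG _).comp (measurable_const.add (measurable_partialSum j))).mul
        (Finset.measurable_prod _ fun j _ => hu.comp (measurable_pi_apply j))
    have hm : Measurable fun x : Fin (K + 1) → EuclideanSpace ℝ (Fin d) =>
        (∏ j ∈ Finset.range (K + 1 + 1), G j (y + partialSum x j)) * ∏ j, u (x j) :=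
      (Finset.measurable_prod _ fun j _ =>
        (hG _).comp (measurable_const.add (measurable_partialSum j))).mul
        (Finset.measurable_prod _ fun j _ => hu.comp (measurable_pi_apply j))
    have hp := (volume_preserving_piFinSuccAbove (fun _ : Fin (K + 1) => EuclideanSpace ℝ (Fin d))
      0).symm
    rw [← hp.lintegral_comp hm, Measure.volume_eq_prod]
    refine (lintegral_prod _ (hm.comp hp.measurable).aemeasurable).trans ?_
    have hcons : ∀ (a : EuclideanSpace ℝ (Fin d)) (x : Fin K → EuclideanSpace ℝ (Fin d)),
        (MeasurableEquiv.piFinSuccAbove (fun _ : Fin (K + 1) => EuclideanSpace ℝ (Fin d))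
          0).symm (a, x) = Fin.cons a x := fun a x => by
      simp [MeasurableEquiv.piFinSuccAbove, Fin.insertNthEquiv]
    simp only [Function.comp_apply, hcons]
    have hmw : Measurable fun x => u x * walkIntegral u K (fun j => G (j + 1)) (y + x) :=
      hu.mul ((measurable_walkIntegral hu K fun j => hG (j + 1)).comp (measurable_const_add y))
    simp only [walkIntegral]
    rw [← lintegral_const_mul _ hmw]
    refine lintegral_congr fun a => ?_
    rw [← ih (fun j => hG (j + 1)), ← lintegral_const_mul _ (hmK _),
      ← lintegral_const_mul _ ((hmK _).const_mul _)]
    refine lintegral_congr fun x => ?_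
    rw [Finset.prod_range_succ', Fin.prod_univ_succ, partialSum_zero, add_zero]
    simp only [partialSum_cons, Fin.cons_zero, Fin.cons_succ, add_assoc]
    ring

lemma lessConcentrated_walkIntegral {n : ℕ} {φ : EuclideanSpace ℝ (Fin (n + 1)) → ℝ}
    (hφ : Measurable φ) (hφv : VanishesAtInfinity φ) (K : ℕ)
    {G G' : ℕ → EuclideanSpace ℝ (Fin (n + 1)) → ℝ≥0∞}
    (hG : ∀ j, IsRearrangedMultiplier (G j) (G' j)) :
    LessConcentrated (walkIntegral (fun x => ENNReal.ofReal (φ x)) K G)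
        (walkIntegral (symmRearrange φ) K G') ∧
      RadiallyDecreasing (walkIntegral (symmRearrange φ) K G') := by
  induction K generalizing G G' with
  | zero =>
    refine ⟨?_, (hG 0).radiallyDecreasing⟩
    simpa [walkIntegral] using (hG 0).lessConcentrated_mul measurable_const measurable_const .one
  | succ K ih =>
    obtain ⟨h1, h2⟩ := ih fun j => hG (j + 1)
    have hV := measurable_walkIntegral hφ.ennreal_ofReal K fun j => (hG (j + 1)).measurable_left
    have hW := measurable_walkIntegral (measurable_symmRearrange φ) K
      fun j => (hG (j + 1)).measurable_right
    refine ⟨(hG 0).lessConcentrated_mul (measurable_lintegral_mul_add hφ.ennreal_ofReal hV)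
      (measurable_lintegral_mul_add (measurable_symmRearrange φ) hW) (h1.conv hV hW h2 hφ hφv),
      (hG 0).radiallyDecreasing.mul ((RadiallyDecreasing.of_symmRearrange φ).conv h2
        (measurable_symmRearrange φ) hW)⟩

lemma prod_eq_prod_range {ι M : Type*} [Fintype ι] [CommMonoid M] {K : ℕ} {k : ι → ℕ}
    (hk : ∀ i, k i ≤ K) (a : ι → ℕ → M) :
    ∏ i, a i (k i) = ∏ j ∈ Finset.range (K + 1), ∏ i, if k i = j then a i j else 1 := by
  rw [Finset.prod_comm]
  refine Finset.prod_congr rfl fun i _ => ?_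
  rw [Finset.prod_ite_eq, if_pos (Finset.mem_range.2 (Nat.lt_succ_of_le (hk i)))]

lemma zero_mem_ballStar {d : ℕ} {A : Set (EuclideanSpace ℝ (Fin d))} (h0 : volume A ≠ 0)
    (hA : volume A ≠ ⊤) : (0 : EuclideanSpace ℝ (Fin d)) ∈ ballStar A := by
  refine Metric.mem_ball_self (Real.rpow_pos_of_pos (ENNReal.toReal_pos ?_ ?_) _)
  · exact ENNReal.div_ne_zero.2 ⟨h0, volume_unit_ball_ne_top⟩
  · exact ENNReal.div_ne_top hA volume_unit_ball_ne_zero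

lemma ofReal_le_symmRearrange_zero {d : ℕ} {f : EuclideanSpace ℝ (Fin d) → ℝ} (hf : Continuous f)
    (hfv : VanishesAtInfinity f) (a : EuclideanSpace ℝ (Fin d)) :
    ENNReal.ofReal (f a) ≤ symmRearrange f 0 := by
  rw [← setLIntegral_Ioi_indicator_ofReal_lt (ENNReal.ofReal (f a))]
  refine setLIntegral_mono' measurableSet_Ioi fun t ht => ?_
  by_cases hta : t < f a
  · have hopen : IsOpen {y | t < f y} := isOpen_lt continuous_const hf
    rw [Set.indicator_of_mem (zero_mem_ballStar (hopen.measure_pos volume ⟨a, hta⟩).ne'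
      (hfv t ht).ne)]
    exact Set.indicator_le_self' (fun _ _ => zero_le) _
  · rw [Set.indicator_of_notMem]
    · exact zero_le
    · exact fun h => hta ((ENNReal.ofReal_lt_ofReal_iff_of_nonneg (le_of_lt ht)).1 h)

lemma indicator_le_indicator_ballStar_zero {d : ℕ} {D : Set (EuclideanSpace ℝ (Fin d))}
    (hD : IsOpen D) (hDne : D.Nonempty) (hDf : volume D ≠ ⊤) (a : EuclideanSpace ℝ (Fin d)) :
    D.indicator (fun _ => (1 : ℝ≥0∞)) a ≤ (ballStar D).indicator (fun _ => 1) 0 := by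
  rw [Set.indicator_of_mem (zero_mem_ballStar (hD.measure_pos volume hDne).ne' hDf)]
  exact Set.indicator_le_self' (fun _ _ => zero_le) _

/-- **Rearrangement inequality for random walks with domain constraints.** -/
theorem random_walk_rearrangement_domains {d m : ℕ} (hd : 1 ≤ d) (hm : 1 ≤ m)
    (φ : EuclideanSpace ℝ (Fin d) → ℝ) (hφ_meas : Measurable φ)
    (hφ_nonneg : ∀ y, 0 ≤ φ y)
    (hφ_prob : ∫⁻ y, ENNReal.ofReal (φ y) = 1)
    (hφ_van : VanishesAtInfinity φ)
    (f : Fin m → EuclideanSpace ℝ (Fin d) → ℝ)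
    (hf_cont : ∀ i, Continuous (f i))
    (hf_nonneg : ∀ i x, 0 ≤ f i x)
    (hf_van : ∀ i, VanishesAtInfinity (f i))
    (D : Fin m → Set (EuclideanSpace ℝ (Fin d)))
    (hD_open : ∀ i, IsOpen (D i))
    (hD_ne : ∀ i, (D i).Nonempty)
    (hD_vol : ∀ i, volume (D i) < ⊤)
    (k : Fin m → ℕ) (hk_mono : Monotone k)
    (K : ℕ) (hK : K = k ⟨m - 1, Nat.sub_lt hm Nat.one_pos⟩) (hK1 : 1 ≤ K)
    (x₀ : EuclideanSpace ℝ (Fin d)) :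
    (∫⁻ x : Fin K → EuclideanSpace ℝ (Fin d),
        (∏ i, ENNReal.ofReal (f i (x₀ + partialSum x (k i))) *
            (D i).indicator (fun _ => (1 : ℝ≥0∞)) (x₀ + partialSum x (k i))) *
          ∏ j, ENNReal.ofReal (φ (x j))) ≤
      ∫⁻ x : Fin K → EuclideanSpace ℝ (Fin d),
        (∏ i, symmRearrange (f i) (partialSum x (k i)) *
            (ballStar (D i)).indicator (fun _ => (1 : ℝ≥0∞)) (partialSum x (k i))) *
          ∏ j, symmRearrange φ (x j) := by
  obtain ⟨n, rfl⟩ : ∃ n, d = n + 1 := ⟨d - 1, by omega⟩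
  obtain ⟨K, rfl⟩ : ∃ K', K = K' + 1 := ⟨K - 1, by omega⟩
  have hkK : ∀ i, k i ≤ K + 1 := fun i => hK ▸ hk_mono (Nat.le_sub_one_of_lt i.2)
  obtain ⟨g, hg⟩ : ∃ g : Fin m → EuclideanSpace ℝ (Fin (n + 1)) → ℝ≥0∞,
    g = fun i y => ENNReal.ofReal (f i y) * (D i).indicator (fun _ => 1) y := ⟨_, rfl⟩
  obtain ⟨g', hg'⟩ : ∃ g' : Fin m → EuclideanSpace ℝ (Fin (n + 1)) → ℝ≥0∞,
    g' = fun i y => symmRearrange (f i) y * (ballStar (D i)).indicator (fun _ => 1) y :=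
    ⟨_, rfl⟩
  have hgg : ∀ i, IsRearrangedMultiplier (g i) (g' i) := fun i => by
    rw [hg, hg']
    exact (IsRearrangedMultiplier.ofReal (hf_cont i).measurable (hf_van i)).mul
      (.indicator (hD_open i).measurableSet (hD_vol i).ne)
  obtain ⟨G, hG⟩ : ∃ G : ℕ → EuclideanSpace ℝ (Fin (n + 1)) → ℝ≥0∞,
    G = fun j y => ∏ i, if k i = j then g i y else 1 := ⟨_, rfl⟩
  obtain ⟨G', hG'⟩ : ∃ G' : ℕ → EuclideanSpace ℝ (Fin (n + 1)) → ℝ≥0∞,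
    G' = fun j y => ∏ i, if k i = j then g' i y else 1 := ⟨_, rfl⟩
  have hGG : ∀ j, IsRearrangedMultiplier (G j) (G' j) := fun j => by
    rw [hG, hG']
    refine .prod Finset.univ fun i => ?_
    split_ifs
    exacts [hgg i, .one]
  have hzero : G 0 x₀ ≤ G' 0 0 := by
    rw [hG, hG']
    refine Finset.prod_le_prod' fun i _ => ?_
    split_ifs
    · rw [hg, hg']
      exact mul_le_mul' (ofReal_le_symmRearrange_zero (hf_cont i) (hf_van i) x₀)
        (indicator_le_indicator_ballStar_zero (hD_open i) (hD_ne i) (hD_vol i).ne x₀)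
    · exact le_rfl
  have hleft : ∀ x : Fin (K + 1) → EuclideanSpace ℝ (Fin (n + 1)),
      (∏ i, ENNReal.ofReal (f i (x₀ + partialSum x (k i))) *
        (D i).indicator (fun _ => (1 : ℝ≥0∞)) (x₀ + partialSum x (k i))) =
      ∏ j ∈ Finset.range (K + 1 + 1), G j (x₀ + partialSum x j) := fun x => by
    rw [hG, ← prod_eq_prod_range hkK fun i j => g i (x₀ + partialSum x j), hg]
  have hright : ∀ x : Fin (K + 1) → EuclideanSpace ℝ (Fin (n + 1)),
      (∏ i, symmRearrange (f i) (partialSum x (k i)) *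
        (ballStar (D i)).indicator (fun _ => (1 : ℝ≥0∞)) (partialSum x (k i))) =
      ∏ j ∈ Finset.range (K + 1 + 1), G' j (0 + partialSum x j) := fun x => by
    simp only [zero_add]
    rw [hG', ← prod_eq_prod_range hkK fun i j => g' i (partialSum x j), hg']
  simp only [hleft, hright]
  rw [lintegral_walk_eq hφ_meas.ennreal_ofReal _ fun j => (hGG j).measurable_left,
    lintegral_walk_eq (measurable_symmRearrange φ) _ fun j => (hGG j).measurable_right]
  exact mul_le_mul' hzero ((lessConcentrated_walkIntegral hφ_meas hφ_van K
    fun j => hGG (j + 1)).1.lintegral_mul_add_le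
      (measurable_walkIntegral hφ_meas.ennreal_ofReal K fun j => (hGG (j + 1)).measurable_left)
      (measurable_walkIntegral (measurable_symmRearrange φ) K
        fun j => (hGG (j + 1)).measurable_right) hφ_meas hφ_van x₀)
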